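/- arXiv:2107.01741 — 3 statements merged into one kernel-verified Lean document; each statement's English description precedes it below -/
import Mathlib

section
/- Let p = p_* := N/(N−4β), γ ∈ ℝ, and suppose: ‖f(·,t)‖_{L^1(ℝ^N)} ≤ C₀ (1+t)^{−γ} for all t ≥ 0; there are R₀, C₁ > 0 with |f(x,t)| ≤ C₁ |x|^{−N} (1+t)^{−γ} for all |x| ≥ R₀ and t ≥ 0; and ‖f(·,t)‖_{L^q(ℝ^N)} ≤ C₀ (1+t)^{−γ} for all t ≥ 0, for some q > q_c(p_*) := N/(2β + N/p_*). Then there is a constant C such that the mild solution u satisfies, for all t ≥ 2: ‖u(·,t)‖_{L^{p_*}(ℝ^N)} ≤ C t^{−γ} if γ < 1+α, and ‖u(·,t)‖_{L^{p_*}(ℝ^N)} ≤ C t^{−(1+α)} log t if γ ≥ 1+α. -/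
open MeasureTheory Real Set Filter
open scoped ENNReal Pointwise

/-- Young's convolution inequality for nonnegative functions. -/
theorem aux_young {E : Type*} [NormedAddCommGroup E] [MeasurableSpace E] [BorelSpace E]
    [SecondCountableTopology E]
    (μ : Measure E) [SFinite μ] [μ.IsAddHaarMeasure] [μ.IsNegInvariant] {p q r : ℝ} (hq : 1 ≤ q) (hr : 1 ≤ r)
    (hp : 1 ≤ p) (hqp : q ≤ p) (hrp : r ≤ p) (h : 1 / r + 1 / q = 1 + 1 / p)
    {K g : E → ℝ≥0∞} (hK : Measurable K) (hg : Measurable g) :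
    (∫⁻ x, (∫⁻ y, K (x - y) * g y ∂μ) ^ p ∂μ) ^ (1 / p) ≤
      (∫⁻ x, K x ^ r ∂μ) ^ (1 / r) * (∫⁻ x, g x ^ q ∂μ) ^ (1 / q) := by
  have hq0 : 0 < q := by linarith
  have hr0 : 0 < r := by linarith
  have hp0 : 0 < p := by linarith
  have e1 : 0 ≤ 1 / r - 1 / p := by
    have := one_div_le_one_div_of_le hr0 hrp
    linarith
  have e2 : 0 ≤ 1 / q - 1 / p := by
    have := one_div_le_one_div_of_le hq0 hqp
    linarith
  have e3 : 0 ≤ 1 / p := by positivity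
  set A := ∫⁻ x, K x ^ r ∂μ with hA
  set B := ∫⁻ x, g x ^ q ∂μ with hB
  have hKx : ∀ x, ∫⁻ y, K (x - y) ^ r ∂μ = A := fun x =>
    lintegral_sub_left_eq_self (μ := μ) (fun z => K z ^ r) x
  have hpt : ∀ x, ∫⁻ y, K (x - y) * g y ∂μ ≤
      (∫⁻ y, K (x - y) ^ r * g y ^ q ∂μ) ^ (1 / p) * (A ^ (1 / r - 1 / p) * B ^ (1 / q - 1 / p)) := by
    intro x
    have hKm : Measurable fun y => K (x - y) := hK.comp (measurable_const.sub measurable_id)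
    have := ENNReal.lintegral_prod_norm_pow_le (μ := μ) (Finset.univ : Finset (Fin 3))
      (f := ![fun y => K (x - y) ^ r * g y ^ q, fun y => K (x - y) ^ r, fun y => g y ^ q])
      (p := ![1 / p, 1 / r - 1 / p, 1 / q - 1 / p]) (by
        intro i _
        fin_cases i
        · exact ((hKm.pow_const r).mul (hg.pow_const q)).aemeasurable
        · exact (hKm.pow_const r).aemeasurable
        · exact (hg.pow_const q).aemeasurable)
      (by simp [Fin.sum_univ_three]; simp at h; linarith)
      (by
        intro i _
        fin_cases i
        · exact e3
        · exact e1
        · exact e2)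
    simp only [Fin.prod_univ_three, Matrix.cons_val_zero, Matrix.cons_val_one, Matrix.cons_val,
      hKx] at this
    rw [mul_assoc] at this
    refine le_trans (le_of_eq (lintegral_congr fun y => ?_)) this
    rw [ENNReal.mul_rpow_of_nonneg _ _ e3]
    have a1 : K (x - y) = (K (x - y) ^ r) ^ (1 / p) * (K (x - y) ^ r) ^ (1 / r - 1 / p) := by
      rw [← ENNReal.rpow_add_of_nonneg _ _ e3 e1, ← ENNReal.rpow_mul]
      have : r * (1 / p + (1 / r - 1 / p)) = 1 := by field_simp; ring
      rw [this, ENNReal.rpow_one]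
    have a2 : g y = (g y ^ q) ^ (1 / p) * (g y ^ q) ^ (1 / q - 1 / p) := by
      rw [← ENNReal.rpow_add_of_nonneg _ _ e3 e2, ← ENNReal.rpow_mul]
      have : q * (1 / p + (1 / q - 1 / p)) = 1 := by field_simp; ring
      rw [this, ENNReal.rpow_one]
    conv_lhs => rw [a1, a2]
    ring
  have hmeas : Measurable (fun z : E × E => K (z.1 - z.2) ^ r * g z.2 ^ q) :=
    ((hK.comp (measurable_fst.sub measurable_snd)).pow_const r).mul
      ((hg.comp measurable_snd).pow_const q)
  have hAB : ∫⁻ x, ∫⁻ y, K (x - y) ^ r * g y ^ q ∂μ ∂μ = A * B := by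
    rw [lintegral_lintegral_swap hmeas.aemeasurable]
    have : ∀ y, ∫⁻ x, K (x - y) ^ r * g y ^ q ∂μ = A * g y ^ q := by
      intro y
      have hKy : Measurable fun x => K (x - y) := hK.comp (measurable_id.sub measurable_const)
      rw [lintegral_mul_const _ (hKy.pow_const r)]
      congr 1
      exact lintegral_sub_right_eq_self (μ := μ) (fun z => K z ^ r) y
    simp_rw [this]
    rw [lintegral_const_mul _ (hg.pow_const q)]
  calc (∫⁻ x, (∫⁻ y, K (x - y) * g y ∂μ) ^ p ∂μ) ^ (1 / p)
      ≤ (∫⁻ x, (∫⁻ y, K (x - y) ^ r * g y ^ q ∂μ) *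
          (A ^ (1 / r - 1 / p) * B ^ (1 / q - 1 / p)) ^ p ∂μ) ^ (1 / p) := by
        gcongr with x
        refine (ENNReal.rpow_le_rpow (hpt x) hp0.le).trans (le_of_eq ?_)
        rw [ENNReal.mul_rpow_of_nonneg _ _ hp0.le, ← ENNReal.rpow_mul]
        rw [one_div_mul_cancel hp0.ne', ENNReal.rpow_one]
    _ = A ^ (1 / r) * B ^ (1 / q) := by
        rw [lintegral_mul_const _ hmeas.lintegral_prod_right', hAB,
          ENNReal.mul_rpow_of_nonneg _ _ e3, ENNReal.mul_rpow_of_nonneg _ _ e3,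
          ← ENNReal.rpow_mul, mul_one_div_cancel hp0.ne', ENNReal.rpow_one]
        have b1 : A ^ (1 / r) = A ^ (1 / p) * A ^ (1 / r - 1 / p) := by
          rw [← ENNReal.rpow_add_of_nonneg _ _ e3 e1]; congr 1; ring
        have b2 : B ^ (1 / q) = B ^ (1 / p) * B ^ (1 / q - 1 / p) := by
          rw [← ENNReal.rpow_add_of_nonneg _ _ e3 e2]; congr 1; ring
        rw [b1, b2]; ring

/-- Minkowski's integral inequality, with a majorant for the norms. -/
theorem aux_mink {X S : Type*} [MeasurableSpace X] [MeasurableSpace S] (μ : Measure X)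
    (ν : Measure S) [SFinite μ] [SFinite ν] {p : ℝ} (hp : 1 ≤ p) {v : X → S → ℝ≥0∞}
    (hv : Measurable (Function.uncurry v)) {M : S → ℝ≥0∞} (hM : Measurable M)
    (hM0 : ∀ᵐ s ∂ν, M s ≠ 0) (hMt : ∀ᵐ s ∂ν, M s ≠ ∞)
    (hb : ∀ᵐ s ∂ν, (∫⁻ x, v x s ^ p ∂μ) ^ (1 / p) ≤ M s) :
    (∫⁻ x, (∫⁻ s, v x s ∂ν) ^ p ∂μ) ^ (1 / p) ≤ ∫⁻ s, M s ∂ν := by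
  have hp0 : 0 < p := by linarith
  have e3 : 0 ≤ 1 / p := by positivity
  have e4 : 0 ≤ 1 - 1 / p := by
    have : 1 / p ≤ 1 := by rw [div_le_one hp0]; exact hp
    linarith
  set I := ∫⁻ s, M s ∂ν with hI
  have hpt : ∀ x, (∫⁻ s, v x s ∂ν) ≤ (∫⁻ s, v x s ^ p * M s ^ (1 - p) ∂ν) ^ (1 / p) *
      I ^ (1 - 1 / p) := by
    intro x
    have hvx : Measurable (v x) := hv.comp measurable_prodMk_left
    have := ENNReal.lintegral_mul_norm_pow_le (μ := ν)
      (f := fun s => v x s ^ p * M s ^ (1 - p)) (g := M)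
      ((hvx.pow_const p).mul (hM.pow_const _)).aemeasurable hM.aemeasurable e3 e4 (by ring)
    refine le_trans (le_of_eq (lintegral_congr_ae ?_)) this
    filter_upwards [hM0, hMt] with s h0 ht
    rw [ENNReal.mul_rpow_of_nonneg _ _ e3, ← ENNReal.rpow_mul, ← ENNReal.rpow_mul,
      mul_one_div_cancel hp0.ne', ENNReal.rpow_one, mul_assoc, ← ENNReal.rpow_add _ _ h0 ht]
    have : (1 - p) * (1 / p) + (1 - 1 / p) = 0 := by field_simp; ring
    rw [this, ENNReal.rpow_zero, mul_one]
  have hmeas : Measurable (fun z : X × S => v z.1 z.2 ^ p * M z.2 ^ (1 - p)) :=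
    (hv.pow_const p).mul ((hM.comp measurable_snd).pow_const _)
  have hint : ∫⁻ x, ∫⁻ s, v x s ^ p * M s ^ (1 - p) ∂ν ∂μ ≤ I := by
    rw [lintegral_lintegral_swap hmeas.aemeasurable]
    refine lintegral_mono_ae ?_
    filter_upwards [hM0, hMt, hb] with s h0 ht hs
    have hvs : Measurable (fun x => v x s) := hv.comp measurable_prodMk_right
    rw [lintegral_mul_const _ (hvs.pow_const p)]
    have : ∫⁻ x, v x s ^ p ∂μ ≤ M s ^ p := by
      have := ENNReal.rpow_le_rpow hs hp0.le
      rwa [← ENNReal.rpow_mul, one_div_mul_cancel hp0.ne', ENNReal.rpow_one] at this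
    refine (mul_le_mul_left this _).trans (le_of_eq ?_)
    rw [← ENNReal.rpow_add _ _ h0 ht]
    simp
  calc (∫⁻ x, (∫⁻ s, v x s ∂ν) ^ p ∂μ) ^ (1 / p)
      ≤ (∫⁻ x, (∫⁻ s, v x s ^ p * M s ^ (1 - p) ∂ν) * (I ^ (1 - 1 / p)) ^ p ∂μ) ^ (1 / p) := by
        gcongr with x
        refine (ENNReal.rpow_le_rpow (hpt x) hp0.le).trans (le_of_eq ?_)
        rw [ENNReal.mul_rpow_of_nonneg _ _ hp0.le, ← ENNReal.rpow_mul]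
        rw [one_div_mul_cancel hp0.ne', ENNReal.rpow_one]
    _ ≤ (I * (I ^ (1 - 1 / p)) ^ p) ^ (1 / p) := by
        rw [lintegral_mul_const _ hmeas.lintegral_prod_right']
        gcongr
    _ = I := by
        rw [ENNReal.mul_rpow_of_nonneg _ _ e3, 
          ← ENNReal.rpow_mul, mul_one_div_cancel hp0.ne', ENNReal.rpow_one,
          ← ENNReal.rpow_add_of_nonneg _ _ e3 e4]
        simp

/-- Interpolation between `L^1` and `L^q`. -/
theorem aux_interp {X : Type*} [MeasurableSpace X] (μ : Measure X) {q q' : ℝ} (hq' : 1 < q')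
    (hqq : q' < q) {g : X → ℝ≥0∞} (hg : Measurable g) {M : ℝ≥0∞} (h1 : ∫⁻ x, g x ∂μ ≤ M)
    (h2 : (∫⁻ x, g x ^ q ∂μ) ^ (1 / q) ≤ M) :
    (∫⁻ x, g x ^ q' ∂μ) ^ (1 / q') ≤ M := by
  have hq0 : 0 < q := by linarith
  have hq0' : 0 < q' := by linarith
  have hd : 0 < q - 1 := by linarith
  have h2' : ∫⁻ x, g x ^ q ∂μ ≤ M ^ q := by
    have := ENNReal.rpow_le_rpow h2 hq0.le
    rwa [← ENNReal.rpow_mul, one_div_mul_cancel hq0.ne', ENNReal.rpow_one] at this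
  set a := (q - q') / (q - 1) with ha
  set b := (q' - 1) / (q - 1) with hb
  have ha0 : 0 ≤ a := div_nonneg (by linarith) hd.le
  have hb0 : 0 ≤ b := div_nonneg (by linarith) hd.le
  have hab : a + b = 1 := by rw [ha, hb]; field_simp; ring
  have hab' : a + q * b = q' := by rw [ha, hb]; field_simp; ring
  have := ENNReal.lintegral_mul_norm_pow_le (μ := μ) (f := g) (g := fun x => g x ^ q)
    hg.aemeasurable (hg.pow_const q).aemeasurable ha0 hb0 hab
  have h3 : ∫⁻ x, g x ^ q' ∂μ ≤ M ^ q' := by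
    calc ∫⁻ x, g x ^ q' ∂μ = ∫⁻ x, g x ^ a * (g x ^ q) ^ b ∂μ := by
          refine lintegral_congr fun x => ?_
          rw [← ENNReal.rpow_mul, ← ENNReal.rpow_add_of_nonneg _ _ ha0 (by positivity), hab']
      _ ≤ (∫⁻ x, g x ∂μ) ^ a * (∫⁻ x, g x ^ q ∂μ) ^ b := this
      _ ≤ M ^ a * (M ^ q) ^ b := by gcongr
      _ = M ^ q' := by
          rw [← ENNReal.rpow_mul, ← ENNReal.rpow_add_of_nonneg _ _ ha0 (by positivity), hab']
  have h4 := ENNReal.rpow_le_rpow h3 (by positivity : 0 ≤ 1 / q')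
  rwa [← ENNReal.rpow_mul, mul_one_div_cancel hq0'.ne', ENNReal.rpow_one] at h4

/-- Scaling. -/
theorem aux_scale {N : ℕ} {c : ℝ} (hc : 0 < c) (F : EuclideanSpace ℝ (Fin N) → ℝ≥0∞)
    (hF : Measurable F) :
    ∫⁻ x, F (c • x) = ENNReal.ofReal (c ^ (-(N : ℝ))) * ∫⁻ x, F x := by
  have h1 := lintegral_map (μ := (volume : Measure (EuclideanSpace ℝ (Fin N)))) hF
    (measurable_const_smul c)
  rw [Measure.map_addHaar_smul _ hc.ne'] at h1
  rw [← h1, lintegral_smul_measure]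
  simp only [finrank_euclideanSpace, Fintype.card_fin, smul_eq_mul]
  congr 2
  rw [Real.rpow_neg hc.le, Real.rpow_natCast, abs_of_pos (by positivity)]
/-- The radial majorant of `G`. -/
noncomputable def auxRad (N : ℕ) (β ρ : ℝ) : ℝ :=
  if ρ ≤ 1 then ρ ^ (4 * β - (N : ℝ)) else ρ ^ (-((N : ℝ) + 2 * β))

theorem auxRad_nonneg (N : ℕ) (β : ℝ) {ρ : ℝ} (hρ : 0 ≤ ρ) : 0 ≤ auxRad N β ρ := by
  unfold auxRad
  split_ifs <;> positivity

theorem auxRad_meas (N : ℕ) (β : ℝ) : Measurable (auxRad N β) := by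
  unfold auxRad
  exact Measurable.ite measurableSet_Iic (by fun_prop) (by fun_prop)

theorem auxRad_in (N : ℕ) (hN : 0 < N) (β r : ℝ) {y : ℝ} (hy : 0 < y) (hy1 : y ≤ 1) :
    y ^ (N - 1) * auxRad N β y ^ r = y ^ ((N : ℝ) - 1 + r * (4 * β - (N : ℝ))) := by
  rw [auxRad, if_pos hy1, ← Real.rpow_mul hy.le, ← Real.rpow_natCast, ← Real.rpow_add hy,
    Nat.cast_sub (by omega)]
  congr 1
  push_cast
  ring

theorem auxRad_out (N : ℕ) (hN : 0 < N) (β r : ℝ) {y : ℝ} (hy1 : 1 < y) :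
    y ^ (N - 1) * auxRad N β y ^ r = y ^ ((N : ℝ) - 1 - r * ((N : ℝ) + 2 * β)) := by
  have hy : 0 < y := by linarith
  rw [auxRad, if_neg (not_le.2 hy1), ← Real.rpow_mul hy.le, ← Real.rpow_natCast, ← Real.rpow_add hy,
    Nat.cast_sub (by omega)]
  congr 1
  push_cast
  ring

theorem auxRad_tail (N : ℕ) (hN : 0 < N) {β r : ℝ} (hβ : 0 < β) (hr : 1 ≤ r) :
    IntegrableOn (fun y : ℝ => y ^ (N - 1) * auxRad N β y ^ r) (Ioi 1) := by
  have : IntegrableOn (fun y : ℝ => y ^ ((N : ℝ) - 1 - r * ((N : ℝ) + 2 * β))) (Ioi 1) := by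
    apply integrableOn_Ioi_rpow_of_lt _ one_pos
    have : (0 : ℝ) < N := by exact_mod_cast hN
    nlinarith
  exact this.congr_fun (fun y hy => (auxRad_out N hN β r hy).symm) measurableSet_Ioi

theorem auxRad_integrable (N : ℕ) (hN : 0 < N) {β r : ℝ} (hβ : 0 < β) (hr : 1 ≤ r)
    (hrp : r * ((N : ℝ) - 4 * β) < N) :
    ∫⁻ x : EuclideanSpace ℝ (Fin N), ENNReal.ofReal (auxRad N β ‖x‖) ^ r < ∞ := by
  have : Nonempty (Fin N) := ⟨⟨0, hN⟩⟩
  have h : Integrable (fun x : EuclideanSpace ℝ (Fin N) => auxRad N β ‖x‖ ^ r) := by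
    rw [integrable_fun_norm_addHaar volume (f := fun y => auxRad N β y ^ r)]
    simp only [finrank_euclideanSpace, Fintype.card_fin, smul_eq_mul]
    rw [← Ioc_union_Ioi_eq_Ioi zero_le_one]
    refine IntegrableOn.union ?_ (auxRad_tail N hN hβ hr)
    have : IntegrableOn (fun y : ℝ => y ^ ((N : ℝ) - 1 + r * (4 * β - (N : ℝ)))) (Ioc 0 1) := by
      rw [← intervalIntegrable_iff_integrableOn_Ioc_of_le zero_le_one]
      apply intervalIntegral.intervalIntegrable_rpow'
      nlinarith
    exact this.congr_fun (fun y hy => (auxRad_in N hN β r hy.1 hy.2).symm) measurableSet_Ioc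
  have h2 := h.lintegral_lt_top
  refine lt_of_le_of_lt (le_of_eq (lintegral_congr fun x => ?_)) h2
  rw [ENNReal.ofReal_rpow_of_nonneg (auxRad_nonneg _ _ (norm_nonneg _)) (by linarith)]

theorem auxRad_log (N : ℕ) (hN : 0 < N) {β p : ℝ} (hβ : 0 < β) (hp : 1 ≤ p)
    (hrp : p * ((N : ℝ) - 4 * β) = N) :
    ∃ K : ℝ, 0 < K ∧ ∀ δ : ℝ, 0 < δ → δ ≤ 1 →
    ∫⁻ x : EuclideanSpace ℝ (Fin N), (if ‖x‖ ≤ δ then 0 else ENNReal.ofReal (auxRad N β ‖x‖) ^ p)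
      ≤ ENNReal.ofReal (K * (1 + Real.log (1 / δ))) := by
  have : Nonempty (Fin N) := ⟨⟨0, hN⟩⟩
  set J := ∫ y in Ioi (1 : ℝ), y ^ (N - 1) * auxRad N β y ^ p with hJ
  have hJ0 : 0 ≤ J := setIntegral_nonneg measurableSet_Ioi (fun y hy => by
    have hy : (1 : ℝ) < y := hy
    have : 0 ≤ y := by linarith
    have := auxRad_nonneg N β this
    positivity)
  set V := (volume : Measure (EuclideanSpace ℝ (Fin N))).real (Metric.ball 0 1)
  have hV : 0 ≤ V := measureReal_nonneg
  refine ⟨N * V * (1 + J) + 1, by positivity, fun δ hδ hδ1 => ?_⟩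
  set φ : ℝ → ℝ := fun y => if y ≤ δ then 0 else auxRad N β y ^ p with hφ
  have e0 : ∀ y ∈ Ioc (0 : ℝ) δ, y ^ (N - 1) * φ y = 0 := by
    intro y hy; simp [hφ, hy.2]
  have e1 : ∀ y ∈ Ioc δ 1, y ^ (N - 1) * φ y = y⁻¹ := by
    intro y hy
    have hy0 : 0 < y := hδ.trans hy.1
    simp only [hφ, if_neg (not_le.2 hy.1)]
    rw [auxRad_in N hN β p hy0 hy.2, ← Real.rpow_neg_one]
    congr 1
    linarith
  have e2 : ∀ y ∈ Ioi (1 : ℝ), y ^ (N - 1) * φ y = y ^ (N - 1) * auxRad N β y ^ p := by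
    intro y hy
    simp only [hφ, if_neg (not_le.2 (lt_of_le_of_lt hδ1 hy))]
  have i0 : IntegrableOn (fun y => y ^ (N - 1) * φ y) (Ioc 0 δ) :=
    (integrableOn_zero).congr_fun (fun y hy => (e0 y hy).symm) measurableSet_Ioc
  have i1 : IntegrableOn (fun y => y ^ (N - 1) * φ y) (Ioc δ 1) := by
    have : IntegrableOn (fun y : ℝ => y⁻¹) (Ioc δ 1) := by
      rw [← intervalIntegrable_iff_integrableOn_Ioc_of_le hδ1]
      apply intervalIntegral.intervalIntegrable_inv
      · intro x hx
        rw [uIcc_of_le hδ1] at hx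
        exact (hδ.trans_le hx.1).ne'
      · exact continuousOn_id
    exact this.congr_fun (fun y hy => (e1 y hy).symm) measurableSet_Ioc
  have i2 : IntegrableOn (fun y => y ^ (N - 1) * φ y) (Ioi 1) :=
    (auxRad_tail N hN hβ hp).congr_fun (fun y hy => (e2 y hy).symm) measurableSet_Ioi
  have i12 : IntegrableOn (fun y => y ^ (N - 1) * φ y) (Ioi δ) := by
    rw [← Ioc_union_Ioi_eq_Ioi hδ1]; exact i1.union i2
  have hint : Integrable (fun x : EuclideanSpace ℝ (Fin N) => φ ‖x‖) := by
    rw [integrable_fun_norm_addHaar volume (f := φ)]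
    simp only [finrank_euclideanSpace, Fintype.card_fin, smul_eq_mul]
    rw [← Ioc_union_Ioi_eq_Ioi hδ.le]
    exact i0.union i12
  have hval : ∫ x : EuclideanSpace ℝ (Fin N), φ ‖x‖ = N * V * (Real.log (1 / δ) + J) := by
    rw [integral_fun_norm_addHaar volume φ]
    simp only [finrank_euclideanSpace, Fintype.card_fin, smul_eq_mul, nsmul_eq_mul]
    rw [← Ioc_union_Ioi_eq_Ioi hδ.le, setIntegral_union (Ioc_disjoint_Ioi le_rfl) measurableSet_Ioi
      i0 i12, setIntegral_congr_fun measurableSet_Ioc e0, ← Ioc_union_Ioi_eq_Ioi hδ1,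
      setIntegral_union (Ioc_disjoint_Ioi le_rfl) measurableSet_Ioi i1 i2,
      setIntegral_congr_fun measurableSet_Ioc e1, setIntegral_congr_fun measurableSet_Ioi e2,
      ← intervalIntegral.integral_of_le hδ1, integral_inv_of_pos hδ one_pos]
    simp [mul_assoc, V, hJ]
  have hφ0 : ∀ x : EuclideanSpace ℝ (Fin N), 0 ≤ φ ‖x‖ := by
    intro x
    simp only [hφ]
    split_ifs
    · exact le_rfl
    · exact Real.rpow_nonneg (auxRad_nonneg _ _ (norm_nonneg _)) _
  calc ∫⁻ x : EuclideanSpace ℝ (Fin N),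
        (if ‖x‖ ≤ δ then 0 else ENNReal.ofReal (auxRad N β ‖x‖) ^ p)
      = ∫⁻ x : EuclideanSpace ℝ (Fin N), ENNReal.ofReal (φ ‖x‖) := by
        refine lintegral_congr fun x => ?_
        simp only [hφ]
        split_ifs
        · simp
        · rw [ENNReal.ofReal_rpow_of_nonneg (auxRad_nonneg _ _ (norm_nonneg _)) (by linarith)]
    _ = ENNReal.ofReal (∫ x : EuclideanSpace ℝ (Fin N), φ ‖x‖) :=
        (ofReal_integral_eq_lintegral_ofReal hint (ae_of_all _ hφ0)).symm
    _ ≤ _ := by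
        apply ENNReal.ofReal_le_ofReal
        rw [hval]
        have hl : 0 ≤ Real.log (1 / δ) := Real.log_nonneg (by rw [le_div_iff₀ hδ]; linarith)
        have hNV : 0 ≤ N * V := by positivity
        nlinarith [mul_nonneg hNV hJ0, mul_nonneg (mul_nonneg hNV hJ0) hl]
/-- A pointwise majorised kernel. -/
structure AuxKer (N : ℕ) (α β c₂ : ℝ) (Y : EuclideanSpace ℝ (Fin N) → ℝ → ℝ) : Prop where
  hN : 0 < N
  hα : 0 < α
  hβ : 0 < β
  hNβ : 4 * β < (N : ℝ)
  hc : 0 < c₂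
  meas : ∀ τ, Measurable fun x => Y x τ
  bd : ∀ x τ, x ≠ 0 → 0 < τ → Y x τ ≤ c₂ * τ ^ (α - 1 - α * (N : ℝ) / (2 * β)) *
    auxRad N β ‖(τ ^ (-(α / (2 * β)))) • x‖

theorem aux_ae_ne {N : ℕ} (hN : 0 < N) : ∀ᵐ x : EuclideanSpace ℝ (Fin N), x ≠ 0 := by
  have : Nonempty (Fin N) := ⟨⟨0, hN⟩⟩
  have : Nontrivial (EuclideanSpace ℝ (Fin N)) := inferInstance
  have := (Set.countable_singleton (0 : EuclideanSpace ℝ (Fin N))).ae_notMem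
    (volume : Measure (EuclideanSpace ℝ (Fin N)))
  filter_upwards [this] with x hx
  simpa using hx

/-- Bookkeeping for powers of constants. -/
theorem aux_root {a b r : ℝ} (ha : 0 ≤ a) (hb : 0 ≤ b) (hr : 0 < r) :
    (ENNReal.ofReal a ^ r * ENNReal.ofReal b) ^ (1 / r) = ENNReal.ofReal (a * b ^ (1 / r)) := by
  have h : 0 ≤ 1 / r := by positivity
  rw [ENNReal.mul_rpow_of_nonneg _ _ h, ← ENNReal.rpow_mul, mul_one_div_cancel hr.ne',
    ENNReal.rpow_one, ENNReal.ofReal_rpow_of_nonneg hb h, ENNReal.ofReal_mul ha]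

theorem AuxKer.k1 {N : ℕ} {α β c₂ : ℝ} {Y : EuclideanSpace ℝ (Fin N) → ℝ → ℝ}
    (H : AuxKer N α β c₂ Y) {r : ℝ} (hr : 1 ≤ r) (hrp : r * ((N : ℝ) - 4 * β) < N) :
    ∃ C : ℝ, 0 < C ∧ ∀ τ : ℝ, 0 < τ →
      (∫⁻ x, ENNReal.ofReal (Y x τ) ^ r) ^ (1 / r) ≤
        ENNReal.ofReal (C * τ ^ (α - 1 - α * (N : ℝ) / (2 * β) + α * N / (2 * β) * (1 / r))) := by
  have hr0 : 0 < r := by linarith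
  have hI := auxRad_integrable N H.hN H.hβ hr hrp
  set I := ∫⁻ x : EuclideanSpace ℝ (Fin N), ENNReal.ofReal (auxRad N β ‖x‖) ^ r with hIdef
  have hc := H.hc
  refine ⟨c₂ * (I.toReal ^ (1 / r) + 1), by positivity, fun τ hτ => ?_⟩
  set c := τ ^ (-(α / (2 * β))) with hcdef
  have hc0 : 0 < c := Real.rpow_pos_of_pos hτ _
  set D := c₂ * τ ^ (α - 1 - α * (N : ℝ) / (2 * β)) with hD
  have hD0 : 0 ≤ D := by positivity
  have hm : Measurable fun ξ : EuclideanSpace ℝ (Fin N) =>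
      ENNReal.ofReal (auxRad N β ‖ξ‖) ^ r :=
    (((auxRad_meas N β).comp measurable_norm).ennreal_ofReal).pow_const r
  have hm' : Measurable fun x : EuclideanSpace ℝ (Fin N) =>
      ENNReal.ofReal (auxRad N β ‖c • x‖) ^ r := hm.comp (measurable_const_smul c)
  have h1 : ∫⁻ x, ENNReal.ofReal (Y x τ) ^ r ≤
      ENNReal.ofReal D ^ r * ENNReal.ofReal (c ^ (-(N : ℝ)) * I.toReal) := by
    calc ∫⁻ x, ENNReal.ofReal (Y x τ) ^ r
        ≤ ∫⁻ x : EuclideanSpace ℝ (Fin N),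
            ENNReal.ofReal D ^ r * ENNReal.ofReal (auxRad N β ‖c • x‖) ^ r := by
          refine lintegral_mono_ae ?_
          filter_upwards [aux_ae_ne H.hN] with x hx
          rw [← ENNReal.mul_rpow_of_nonneg _ _ hr0.le, ← ENNReal.ofReal_mul hD0]
          exact ENNReal.rpow_le_rpow (ENNReal.ofReal_le_ofReal (H.bd x τ hx hτ)) hr0.le
      _ = ENNReal.ofReal D ^ r * (ENNReal.ofReal (c ^ (-(N : ℝ))) * I) := by
          rw [lintegral_const_mul _ hm', aux_scale hc0 _ hm]
      _ = _ := by
          rw [ENNReal.ofReal_mul (p := c ^ (-(N : ℝ))) (by positivity), ENNReal.ofReal_toReal hI.ne]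
  refine (ENNReal.rpow_le_rpow h1 (by positivity)).trans ?_
  rw [aux_root hD0 (by positivity) hr0]
  apply ENNReal.ofReal_le_ofReal
  rw [Real.mul_rpow (by positivity) (by positivity), hD, hcdef, ← Real.rpow_mul hτ.le,
    ← Real.rpow_mul hτ.le, Real.rpow_add hτ]
  have : -(α / (2 * β)) * -(N : ℝ) * (1 / r) = α * N / (2 * β) * (1 / r) := by ring
  rw [this]
  have p1 : 0 ≤ c₂ * τ ^ (α - 1 - α * (N : ℝ) / (2 * β)) * τ ^ (α * N / (2 * β) * (1 / r)) := by
    positivity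
  nlinarith

theorem AuxKer.k2 {N : ℕ} {α β c₂ : ℝ} {Y : EuclideanSpace ℝ (Fin N) → ℝ → ℝ}
    (H : AuxKer N α β c₂ Y) {r : ℝ} (hr : 1 ≤ r) (hrp : r * ((N : ℝ) - 4 * β) < N) :
    ∃ C : ℝ, 0 < C ∧ ∀ τ : ℝ, 1 ≤ τ →
      (∫⁻ x, (if ‖x‖ ≤ 1 then ENNReal.ofReal (Y x τ) else 0) ^ r) ^ (1 / r) ≤
        ENNReal.ofReal (C * τ ^ (-1 - α)) := by
  have hr0 : 0 < r := by linarith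
  have hI := auxRad_integrable N H.hN H.hβ hr hrp
  set I := ∫⁻ x : EuclideanSpace ℝ (Fin N), ENNReal.ofReal (auxRad N β ‖x‖) ^ r with hIdef
  have hc := H.hc
  have hβ := H.hβ
  have hα := H.hα
  refine ⟨c₂ * (I.toReal ^ (1 / r) + 1), by positivity, fun τ hτ1 => ?_⟩
  have hτ : 0 < τ := by linarith
  set D := c₂ * τ ^ (-1 - α) with hD
  have hD0 : 0 ≤ D := by positivity
  have hm : Measurable fun ξ : EuclideanSpace ℝ (Fin N) =>
      ENNReal.ofReal (auxRad N β ‖ξ‖) ^ r :=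
    (((auxRad_meas N β).comp measurable_norm).ennreal_ofReal).pow_const r
  have hpt : ∀ x : EuclideanSpace ℝ (Fin N), x ≠ 0 → ‖x‖ ≤ 1 → Y x τ ≤ D * auxRad N β ‖x‖ := by
    intro x hx hx1
    refine (H.bd x τ hx hτ).trans (le_of_eq ?_)
    set c := τ ^ (-(α / (2 * β))) with hcdef
    have hc0 : 0 < c := Real.rpow_pos_of_pos hτ _
    have hc1 : c ≤ 1 := Real.rpow_le_one_of_one_le_of_nonpos hτ1 (by
      have : 0 ≤ α / (2 * β) := by positivity
      linarith)
    have hn : ‖c • x‖ = c * ‖x‖ := by rw [norm_smul, Real.norm_of_nonneg hc0.le]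
    have hle : c * ‖x‖ ≤ 1 := mul_le_one₀ hc1 (norm_nonneg _) hx1
    rw [hn, auxRad, if_pos hle, auxRad, if_pos hx1, Real.mul_rpow hc0.le (norm_nonneg _), hcdef,
      ← Real.rpow_mul hτ.le, hD, mul_assoc, ← mul_assoc (τ ^ _), ← Real.rpow_add hτ, mul_assoc]
    congr 3
    field_simp
    ring
  have h1 : ∫⁻ x, (if ‖x‖ ≤ 1 then ENNReal.ofReal (Y x τ) else 0) ^ r ≤
      ENNReal.ofReal D ^ r * ENNReal.ofReal (I.toReal) := by
    rw [ENNReal.ofReal_toReal hI.ne, hIdef, ← lintegral_const_mul _ hm]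
    refine lintegral_mono_ae ?_
    filter_upwards [aux_ae_ne H.hN] with x hx
    rw [← ENNReal.mul_rpow_of_nonneg _ _ hr0.le, ← ENNReal.ofReal_mul hD0]
    refine ENNReal.rpow_le_rpow ?_ hr0.le
    split_ifs with hx1
    · exact ENNReal.ofReal_le_ofReal (hpt x hx hx1)
    · exact zero_le
  refine (ENNReal.rpow_le_rpow h1 (by positivity)).trans ?_
  rw [aux_root hD0 (by positivity) hr0]
  apply ENNReal.ofReal_le_ofReal
  have p1 : 0 ≤ c₂ * τ ^ (-1 - α) := by positivity
  rw [hD]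
  nlinarith

theorem AuxKer.k3 {N : ℕ} {α β c₂ : ℝ} {Y : EuclideanSpace ℝ (Fin N) → ℝ → ℝ}
    (H : AuxKer N α β c₂ Y) {p : ℝ} (hp : 1 ≤ p) (hrp : p * ((N : ℝ) - 4 * β) = N) :
    ∃ C : ℝ, 0 < C ∧ ∀ τ : ℝ, 1 ≤ τ →
      (∫⁻ x, (if ‖x‖ ≤ 1 then 0 else ENNReal.ofReal (Y x τ)) ^ p) ^ (1 / p) ≤
        ENNReal.ofReal (C * (τ ^ (-1 - α) * (1 + Real.log τ))) := by
  have hr0 : 0 < p := by linarith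
  obtain ⟨K, hK0, hK⟩ := auxRad_log N H.hN H.hβ hp hrp
  have hc := H.hc
  have hβ := H.hβ
  have hα := H.hα
  set κ := α / (2 * β) with hκ
  have hκ0 : 0 < κ := by positivity
  refine ⟨c₂ * ((1 + K) * (1 + κ)), by positivity, fun τ hτ1 => ?_⟩
  have hτ : 0 < τ := by linarith
  have hl : 0 ≤ Real.log τ := Real.log_nonneg hτ1
  set c := τ ^ (-κ) with hcdef
  have hc0 : 0 < c := Real.rpow_pos_of_pos hτ _
  have hc1 : c ≤ 1 := Real.rpow_le_one_of_one_le_of_nonpos hτ1 (by linarith)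
  set D := c₂ * τ ^ (α - 1 - α * (N : ℝ) / (2 * β)) with hD
  have hD0 : 0 ≤ D := by positivity
  have hm : Measurable fun ξ : EuclideanSpace ℝ (Fin N) =>
      (if ‖ξ‖ ≤ c then 0 else ENNReal.ofReal (auxRad N β ‖ξ‖) ^ p) :=
    Measurable.ite (measurableSet_le measurable_norm measurable_const) measurable_const
      ((((auxRad_meas N β).comp measurable_norm).ennreal_ofReal).pow_const p)
  have hm' : Measurable fun x : EuclideanSpace ℝ (Fin N) =>
      (if ‖c • x‖ ≤ c then 0 else ENNReal.ofReal (auxRad N β ‖c • x‖) ^ p) :=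
    hm.comp (measurable_const_smul c)
  have hlog : Real.log (1 / c) = κ * Real.log τ := by
    rw [one_div, Real.log_inv, hcdef, Real.log_rpow hτ]; ring
  set z := (1 + K) * (1 + κ) * (1 + Real.log τ) with hz
  have hz1 : 1 ≤ z := by
    have a1 : 1 ≤ (1 + K) * (1 + κ) := by nlinarith
    rw [hz]; nlinarith
  have hKz : K * (1 + Real.log (1 / c)) ≤ z := by
    rw [hlog, hz]
    have := mul_nonneg hκ0.le hl
    have := mul_nonneg hK0.le hl
    have := mul_nonneg hK0.le hκ0.le
    nlinarith
  have h1 : ∫⁻ x, (if ‖x‖ ≤ 1 then 0 else ENNReal.ofReal (Y x τ)) ^ p ≤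
      ENNReal.ofReal D ^ p * ENNReal.ofReal (c ^ (-(N : ℝ)) * z) := by
    calc ∫⁻ x, (if ‖x‖ ≤ 1 then 0 else ENNReal.ofReal (Y x τ)) ^ p
        ≤ ∫⁻ x : EuclideanSpace ℝ (Fin N), ENNReal.ofReal D ^ p *
            (if ‖c • x‖ ≤ c then 0 else ENNReal.ofReal (auxRad N β ‖c • x‖) ^ p) := by
          refine lintegral_mono_ae ?_
          filter_upwards [aux_ae_ne H.hN] with x hx
          have hn : ‖c • x‖ = c * ‖x‖ := by rw [norm_smul, Real.norm_of_nonneg hc0.le]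
          by_cases hx1 : ‖x‖ ≤ 1
          · simp [hx1, hr0]
          · have : ¬ (‖c • x‖ ≤ c) := by
              rw [hn]; push Not at hx1 ⊢; nlinarith
            rw [if_neg hx1, if_neg this]
            rw [← ENNReal.mul_rpow_of_nonneg _ _ hr0.le, ← ENNReal.ofReal_mul hD0]
            exact ENNReal.rpow_le_rpow (ENNReal.ofReal_le_ofReal (H.bd x τ hx hτ)) hr0.le
      _ = ENNReal.ofReal D ^ p * (ENNReal.ofReal (c ^ (-(N : ℝ))) *
            ∫⁻ ξ : EuclideanSpace ℝ (Fin N),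
              (if ‖ξ‖ ≤ c then 0 else ENNReal.ofReal (auxRad N β ‖ξ‖) ^ p)) := by
          rw [lintegral_const_mul _ hm', aux_scale hc0 _ hm]
      _ ≤ _ := by
          rw [ENNReal.ofReal_mul (p := c ^ (-(N : ℝ))) (by positivity)]
          gcongr
          exact (hK c hc0 hc1).trans (ENNReal.ofReal_le_ofReal hKz)
  have hz0 : 0 ≤ z := by linarith
  refine (ENNReal.rpow_le_rpow h1 (by positivity)).trans ?_
  rw [aux_root hD0 (by positivity) hr0]
  apply ENNReal.ofReal_le_ofReal
  rw [Real.mul_rpow (by positivity) hz0, hD, hcdef, ← Real.rpow_mul hτ.le,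
    ← Real.rpow_mul hτ.le]
  have hzp : z ^ (1 / p) ≤ z := by
    have := Real.rpow_le_rpow_of_exponent_le hz1 (show 1 / p ≤ 1 by rw [div_le_one hr0]; exact hp)
    rwa [Real.rpow_one] at this
  have hexp : τ ^ (-1 - α) = τ ^ (α - 1 - α * (N : ℝ) / (2 * β)) * τ ^ (-κ * -(N : ℝ) * (1 / p)) := by
    rw [← Real.rpow_add hτ]
    congr 1
    have : (N : ℝ) * (1 / p) = N - 4 * β := by
      rw [← hrp]; field_simp
      have h0 : (N : ℝ) - 4 * β ≠ 0 := by have := H.hNβ; linarith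
      nlinarith
    rw [neg_mul_neg, mul_assoc, this, hκ]
    field_simp
    ring
  have p1 : 0 ≤ c₂ * τ ^ (-1 - α) := by positivity
  calc c₂ * τ ^ (α - 1 - α * (N : ℝ) / (2 * β)) * (τ ^ (-κ * -(N : ℝ) * (1 / p)) * z ^ (1 / p))
      = c₂ * τ ^ (-1 - α) * z ^ (1 / p) := by rw [hexp]; ring
    _ ≤ c₂ * τ ^ (-1 - α) * z := by gcongr
    _ = _ := by rw [hz]; ring
/-- The temporal majorant. -/
noncomputable def auxM (a α τ : ℝ) : ℝ :=
  if τ < 1 then τ ^ (a - 1) else τ ^ (-1 - α) * (1 + Real.log τ)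

theorem auxM_pos {a α τ : ℝ} (hτ : 0 < τ) : 0 < auxM a α τ := by
  unfold auxM
  split_ifs with h
  · positivity
  · have := Real.log_nonneg (not_lt.1 h)
    positivity

theorem auxM_meas (a α : ℝ) : Measurable (auxM a α) := by
  unfold auxM
  refine Measurable.ite measurableSet_Iio (by fun_prop) ?_
  exact (by fun_prop : Measurable fun τ : ℝ => τ ^ (-1 - α)).mul
    (measurable_const.add Real.measurable_log)

theorem auxM_fin {a α : ℝ} (ha : 0 < a) (hα : 0 < α) :
    ∫⁻ τ in Ioi (0 : ℝ), ENNReal.ofReal (auxM a α τ) < ∞ := by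
  rw [← Ioc_union_Ioi_eq_Ioi zero_le_one]
  refine lt_of_le_of_lt (lintegral_union_le _ _ _) (ENNReal.add_lt_top.2 ⟨?_, ?_⟩)
  · have h : IntegrableOn (fun y : ℝ => y ^ (a - 1) + 1) (Ioc 0 1) := by
      refine Integrable.add ?_ (integrableOn_const (by simp))
      change IntegrableOn _ _ _
      rw [← intervalIntegrable_iff_integrableOn_Ioc_of_le zero_le_one]
      exact intervalIntegral.intervalIntegrable_rpow' (by linarith)
    refine lt_of_le_of_lt (setLIntegral_mono' measurableSet_Ioc fun τ hτ => ?_) h.lintegral_lt_top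
    apply ENNReal.ofReal_le_ofReal
    unfold auxM
    have h0 : 0 ≤ τ ^ (a - 1) := Real.rpow_nonneg hτ.1.le _
    split_ifs with h
    · linarith
    · have : τ = 1 := le_antisymm hτ.2 (not_lt.1 h)
      subst this
      simp
  · have h : IntegrableOn (fun y : ℝ => (1 + 2 / α) * y ^ (-1 - α / 2)) (Ioi 1) :=
      (integrableOn_Ioi_rpow_of_lt (by linarith) one_pos).const_mul _
    refine lt_of_le_of_lt (setLIntegral_mono' measurableSet_Ioi fun τ hτ => ?_) h.lintegral_lt_top
    apply ENNReal.ofReal_le_ofReal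
    have hτ : 1 < τ := hτ
    have hτ0 : 0 < τ := by linarith
    unfold auxM
    rw [if_neg (not_lt.2 hτ.le)]
    have h1 : Real.log τ ≤ τ ^ (α / 2) / (α / 2) := Real.log_le_rpow_div hτ0.le (by positivity)
    have h2 : 1 ≤ τ ^ (α / 2) := Real.one_le_rpow hτ.le (by positivity)
    have h3 : 1 + Real.log τ ≤ (1 + 2 / α) * τ ^ (α / 2) := by
      have : τ ^ (α / 2) / (α / 2) = 2 / α * τ ^ (α / 2) := by field_simp
      rw [this] at h1
      linarith
    calc τ ^ (-1 - α) * (1 + Real.log τ) ≤ τ ^ (-1 - α) * ((1 + 2 / α) * τ ^ (α / 2)) := by gcongr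
      _ = (1 + 2 / α) * (τ ^ (-1 - α) * τ ^ (α / 2)) := by ring
      _ = _ := by
        rw [← Real.rpow_add hτ0]
        congr 2
        ring

theorem aux_cmp {x t γ : ℝ} (ht : 0 < t) (h1 : t / 2 ≤ x) (h2 : x ≤ 2 * t) :
    x ^ (-γ) ≤ 2 ^ |γ| * t ^ (-γ) := by
  have hx : 0 < x := by linarith
  rcases le_total 0 γ with hγ | hγ
  · rw [abs_of_nonneg hγ]
    calc x ^ (-γ) ≤ (t / 2) ^ (-γ) :=
          Real.rpow_le_rpow_of_nonpos (by positivity) h1 (by linarith)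
      _ = 2 ^ γ * t ^ (-γ) := by
          rw [Real.div_rpow ht.le (by norm_num), Real.rpow_neg (by norm_num : (0 : ℝ) ≤ 2)]
          field_simp
  · rw [abs_of_nonpos hγ]
    calc x ^ (-γ) ≤ (2 * t) ^ (-γ) := Real.rpow_le_rpow hx.le h2 (by linarith)
      _ = _ := Real.mul_rpow (by norm_num) ht.le

theorem aux_pow_int {κ t : ℝ} (hκ : κ ≠ 0) (ht : 0 ≤ t) :
    ∫⁻ s in Ioc (0 : ℝ) t, ENNReal.ofReal ((1 + s) ^ (κ - 1)) =
      ENNReal.ofReal (((1 + t) ^ κ - 1) / κ) := by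
  have hc : ContinuousOn (fun s : ℝ => (1 + s) ^ (κ - 1)) (Icc 0 t) := by
    refine ContinuousOn.rpow_const (by fun_prop) fun s hs => Or.inl ?_
    have := hs.1
    positivity
  have hi : IntegrableOn (fun s : ℝ => (1 + s) ^ (κ - 1)) (Ioc 0 t) :=
    hc.integrableOn_Icc.mono_set Ioc_subset_Icc_self
  rw [← ofReal_integral_eq_lintegral_ofReal hi]
  · rw [← intervalIntegral.integral_of_le ht,
      intervalIntegral.integral_comp_add_left (fun s => s ^ (κ - 1)) 1, integral_rpow]
    · simp
    · right
      refine ⟨by intro h; apply hκ; linarith, ?_⟩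
      rw [uIcc_of_le (by linarith)]
      intro h
      have := h.1
      linarith
  · filter_upwards [ae_restrict_mem measurableSet_Ioc] with s hs
    have := hs.1
    simp only [Pi.zero_apply]
    positivity

/-- The integral near the final time. -/
theorem aux_near {a α γ : ℝ} (ha : 0 < a) (hα : 0 < α) :
    ∃ C : ℝ, 0 < C ∧ ∀ t : ℝ, 2 ≤ t →
      ∫⁻ s in Ioo (t / 2) t, ENNReal.ofReal ((1 + s) ^ (-γ) * auxM a α (t - s)) ≤
        ENNReal.ofReal (C * t ^ (-γ)) := by
  have hfin := auxM_fin ha hα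
  set I := ∫⁻ τ in Ioi (0 : ℝ), ENNReal.ofReal (auxM a α τ) with hI
  refine ⟨2 ^ |γ| * (I.toReal + 1), by positivity, fun t ht => ?_⟩
  have ht0 : 0 < t := by linarith
  have hm : Measurable fun s => ENNReal.ofReal (auxM a α (t - s)) :=
    ((auxM_meas a α).comp (measurable_const.sub measurable_id)).ennreal_ofReal
  have h1 : ∫⁻ s in Ioo (t / 2) t, ENNReal.ofReal (auxM a α (t - s)) ≤ I := by
    calc ∫⁻ s in Ioo (t / 2) t, ENNReal.ofReal (auxM a α (t - s))
        ≤ ∫⁻ s in Iio t, ENNReal.ofReal (auxM a α (t - s)) :=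
          lintegral_mono_set Ioo_subset_Iio_self
      _ = ∫⁻ s, (Ioi (0 : ℝ)).indicator (fun τ => ENNReal.ofReal (auxM a α τ)) (t - s) := by
          rw [← lintegral_indicator measurableSet_Iio]
          refine lintegral_congr fun s => ?_
          by_cases hs : s < t
          · simp [hs]
          · simp [hs]
      _ = I := by
          rw [lintegral_sub_left_eq_self (μ := volume)
            ((Ioi (0 : ℝ)).indicator (fun τ => ENNReal.ofReal (auxM a α τ))) t,
            lintegral_indicator measurableSet_Ioi]
  calc ∫⁻ s in Ioo (t / 2) t, ENNReal.ofReal ((1 + s) ^ (-γ) * auxM a α (t - s))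
      ≤ ∫⁻ s in Ioo (t / 2) t, ENNReal.ofReal (2 ^ |γ| * t ^ (-γ)) *
          ENNReal.ofReal (auxM a α (t - s)) := by
        refine setLIntegral_mono' measurableSet_Ioo fun s hs => ?_
        rw [← ENNReal.ofReal_mul (by positivity)]
        apply ENNReal.ofReal_le_ofReal
        have h3 := hs.1
        have h4 := hs.2
        have := (auxM_pos (a := a) (α := α) (sub_pos.2 h4)).le
        gcongr
        exact aux_cmp ht0 (by linarith) (by linarith)
    _ ≤ ENNReal.ofReal (2 ^ |γ| * t ^ (-γ)) * I := by
        rw [lintegral_const_mul _ hm]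
        gcongr
    _ = ENNReal.ofReal (2 ^ |γ| * t ^ (-γ) * I.toReal) := by
        rw [ENNReal.ofReal_mul (p := 2 ^ |γ| * t ^ (-γ)) (by positivity),
          ENNReal.ofReal_toReal hfin.ne]
    _ ≤ _ := by
        apply ENNReal.ofReal_le_ofReal
        have : 0 ≤ 2 ^ |γ| * t ^ (-γ) := by positivity
        nlinarith

/-- The integral away from the final time. -/
theorem aux_far {a α γ : ℝ} :
    ∃ C : ℝ, 0 < C ∧ ∀ t : ℝ, 2 ≤ t → ∀ B : ℝ, 0 ≤ B →
      ∫⁻ s in Ioc (0 : ℝ) (t / 2), ENNReal.ofReal ((1 + s) ^ (-γ)) ≤ ENNReal.ofReal B →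
      ∫⁻ s in Ioc (0 : ℝ) (t / 2), ENNReal.ofReal ((1 + s) ^ (-γ) * auxM a α (t - s)) ≤
        ENNReal.ofReal (C * t ^ (-(1 + α)) * Real.log t * B) := by
  refine ⟨2 ^ |1 + α| * 3, by positivity, fun t ht B hB hBint => ?_⟩
  have ht0 : 0 < t := by linarith
  have hlog : 1 / 2 ≤ Real.log t := by
    have h1 := Real.log_le_log (by norm_num) ht
    have h2 := Real.log_two_gt_d9
    linarith
  set D := 2 ^ |1 + α| * 3 * t ^ (-(1 + α)) * Real.log t with hD
  have hD0 : 0 ≤ D := by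
    have : 0 ≤ Real.log t := by linarith
    positivity
  have hm : Measurable fun s : ℝ => ENNReal.ofReal ((1 + s) ^ (-γ)) :=
    (by fun_prop : Measurable fun s : ℝ => (1 + s) ^ (-γ)).ennreal_ofReal
  calc ∫⁻ s in Ioc (0 : ℝ) (t / 2), ENNReal.ofReal ((1 + s) ^ (-γ) * auxM a α (t - s))
      ≤ ∫⁻ s in Ioc (0 : ℝ) (t / 2), ENNReal.ofReal D * ENNReal.ofReal ((1 + s) ^ (-γ)) := by
        refine setLIntegral_mono' measurableSet_Ioc fun s hs => ?_
        rw [← ENNReal.ofReal_mul hD0]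
        apply ENNReal.ofReal_le_ofReal
        rw [mul_comm]
        have h3 := hs.1
        have h4 := hs.2
        have hs0 : 0 ≤ (1 + s) ^ (-γ) := by positivity
        refine mul_le_mul_of_nonneg_right ?_ hs0
        have h5 : 1 ≤ t - s := by linarith
        rw [auxM, if_neg (not_lt.2 h5)]
        have h6 := aux_cmp (γ := 1 + α) ht0 (show t / 2 ≤ t - s by linarith) (by linarith)
        have h7 : Real.log (t - s) ≤ Real.log t := Real.log_le_log (by linarith) (by linarith)
        have h8 : 0 ≤ Real.log (t - s) := Real.log_nonneg h5
        have h9 : -1 - α = -(1 + α) := by ring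
        rw [h9]
        calc (t - s) ^ (-(1 + α)) * (1 + Real.log (t - s))
            ≤ (2 ^ |1 + α| * t ^ (-(1 + α))) * (3 * Real.log t) := by
              gcongr
              linarith
          _ = D := by rw [hD]; ring
    _ = ENNReal.ofReal D * ∫⁻ s in Ioc (0 : ℝ) (t / 2), ENNReal.ofReal ((1 + s) ^ (-γ)) := by
        rw [lintegral_const_mul _ hm]
    _ ≤ ENNReal.ofReal D * ENNReal.ofReal B := by gcongr
    _ = _ := by rw [← ENNReal.ofReal_mul hD0]

theorem aux_time {a α γ : ℝ} (ha : 0 < a) (hα : 0 < α) :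
    ∃ C : ℝ, 0 < C ∧ ∀ t : ℝ, 2 ≤ t →
      (γ < 1 + α →
        ∫⁻ s in Ioo (0 : ℝ) t, ENNReal.ofReal ((1 + s) ^ (-γ) * auxM a α (t - s)) ≤
          ENNReal.ofReal (C * t ^ (-γ))) ∧
      (1 + α ≤ γ →
        ∫⁻ s in Ioo (0 : ℝ) t, ENNReal.ofReal ((1 + s) ^ (-γ) * auxM a α (t - s)) ≤
          ENNReal.ofReal (C * t ^ (-(1 + α)) * Real.log t)) := by
  obtain ⟨Cn, hCn, hn⟩ := aux_near (γ := γ) ha hα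
  obtain ⟨Cf, hCf, hf⟩ := aux_far (a := a) (α := α) (γ := γ)
  have hsplit : ∀ t : ℝ, 2 ≤ t →
      ∫⁻ s in Ioo (0 : ℝ) t, ENNReal.ofReal ((1 + s) ^ (-γ) * auxM a α (t - s)) ≤
      (∫⁻ s in Ioc (0 : ℝ) (t / 2), ENNReal.ofReal ((1 + s) ^ (-γ) * auxM a α (t - s))) +
      ∫⁻ s in Ioo (t / 2) t, ENNReal.ofReal ((1 + s) ^ (-γ) * auxM a α (t - s)) := by
    intro t ht
    rw [← Ioc_union_Ioo_eq_Ioo (show (0 : ℝ) ≤ t / 2 by linarith) (show t / 2 < t by linarith)]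
    exact lintegral_union_le _ _ _
  rcases lt_or_ge γ (1 + α) with hγ | hγ
  · obtain ⟨κ, hκ1, hκ2⟩ : ∃ κ, max 0 (1 - γ) < κ ∧ κ < 1 + α - γ :=
      exists_between (max_lt (by linarith) (by linarith))
    have hκ0 : 0 < κ := lt_of_le_of_lt (le_max_left _ _) hκ1
    have hκ3 : 1 - γ < κ := lt_of_le_of_lt (le_max_right _ _) hκ1
    set η := 1 + α - γ - κ with hη
    have hη0 : 0 < η := by rw [hη]; linarith
    refine ⟨Cf * (2 ^ κ / κ) / η + Cn, by positivity, fun t ht => ⟨fun _ => ?_, fun h => ?_⟩⟩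
    swap
    · linarith
    have ht0 : 0 < t := by linarith
    have hB : ∫⁻ s in Ioc (0 : ℝ) (t / 2), ENNReal.ofReal ((1 + s) ^ (-γ)) ≤
        ENNReal.ofReal (2 ^ κ / κ * t ^ κ) := by
      calc ∫⁻ s in Ioc (0 : ℝ) (t / 2), ENNReal.ofReal ((1 + s) ^ (-γ))
          ≤ ∫⁻ s in Ioc (0 : ℝ) (t / 2), ENNReal.ofReal ((1 + s) ^ (κ - 1)) := by
            refine setLIntegral_mono' measurableSet_Ioc fun s hs => ?_
            apply ENNReal.ofReal_le_ofReal
            have := hs.1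
            exact Real.rpow_le_rpow_of_exponent_le (by linarith) (by linarith)
        _ = _ := aux_pow_int hκ0.ne' (by linarith)
        _ ≤ _ := by
            apply ENNReal.ofReal_le_ofReal
            rw [div_mul_eq_mul_div, ← Real.mul_rpow (by norm_num) ht0.le]
            have : (1 + t / 2) ^ κ ≤ (2 * t) ^ κ :=
              Real.rpow_le_rpow (by linarith) (by linarith) hκ0.le
            gcongr
            linarith
    refine (hsplit t ht).trans ((add_le_add (hf t ht _ (by positivity) hB) (hn t ht)).trans ?_)
    have hlog0 : 0 ≤ Real.log t := Real.log_nonneg (by linarith)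
    rw [← ENNReal.ofReal_add (by positivity) (by positivity)]
    apply ENNReal.ofReal_le_ofReal
    rw [add_mul]
    refine add_le_add ?_ le_rfl
    have hlog : Real.log t ≤ t ^ η / η := Real.log_le_rpow_div ht0.le hη0
    calc Cf * t ^ (-(1 + α)) * Real.log t * (2 ^ κ / κ * t ^ κ)
        ≤ Cf * t ^ (-(1 + α)) * (t ^ η / η) * (2 ^ κ / κ * t ^ κ) := by gcongr
      _ = Cf * (2 ^ κ / κ) / η * (t ^ (-(1 + α)) * t ^ η * t ^ κ) := by ring
      _ = Cf * (2 ^ κ / κ) / η * t ^ (-γ) := by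
          rw [← Real.rpow_add ht0, ← Real.rpow_add ht0]
          congr 2
          rw [hη]; ring
  · refine ⟨Cf * (1 / α) + Cn * 2, by positivity, fun t ht => ⟨fun h => ?_, fun _ => ?_⟩⟩
    · linarith
    have ht0 : 0 < t := by linarith
    have hB : ∫⁻ s in Ioc (0 : ℝ) (t / 2), ENNReal.ofReal ((1 + s) ^ (-γ)) ≤
        ENNReal.ofReal (1 / α) := by
      calc ∫⁻ s in Ioc (0 : ℝ) (t / 2), ENNReal.ofReal ((1 + s) ^ (-γ))
          ≤ ∫⁻ s in Ioc (0 : ℝ) (t / 2), ENNReal.ofReal ((1 + s) ^ (-α - 1)) := by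
            refine setLIntegral_mono' measurableSet_Ioc fun s hs => ?_
            apply ENNReal.ofReal_le_ofReal
            have := hs.1
            exact Real.rpow_le_rpow_of_exponent_le (by linarith) (by linarith)
        _ = _ := aux_pow_int (neg_ne_zero.2 hα.ne') (by linarith)
        _ ≤ _ := by
            apply ENNReal.ofReal_le_ofReal
            rw [div_neg, ← neg_div]
            have : 0 ≤ (1 + t / 2) ^ (-α) := by positivity
            gcongr
            linarith
    have hlog : 1 / 2 ≤ Real.log t := by
      have h1 := Real.log_le_log (by norm_num) ht
      have h2 := Real.log_two_gt_d9
      linarith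
    refine (hsplit t ht).trans ((add_le_add (hf t ht _ (by positivity) hB) (hn t ht)).trans ?_)
    have hlog0 : 0 ≤ Real.log t := Real.log_nonneg (by linarith)
    rw [← ENNReal.ofReal_add (by positivity) (by positivity)]
    apply ENNReal.ofReal_le_ofReal
    have h1 : t ^ (-γ) ≤ t ^ (-(1 + α)) :=
      Real.rpow_le_rpow_of_exponent_le (by linarith) (by linarith)
    have h2 : Cn * t ^ (-γ) ≤ Cn * 2 * t ^ (-(1 + α)) * Real.log t := by
      calc Cn * t ^ (-γ) ≤ Cn * t ^ (-(1 + α)) := by gcongr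
        _ = Cn * t ^ (-(1 + α)) * 1 := by ring
        _ ≤ Cn * t ^ (-(1 + α)) * (2 * Real.log t) := by gcongr; linarith
        _ = _ := by ring
    calc _ ≤ Cf * t ^ (-(1 + α)) * Real.log t * (1 / α) + Cn * 2 * t ^ (-(1 + α)) * Real.log t := by
          gcongr
      _ = _ := by ring
/-- The convolution estimate at a fixed time lag. -/
theorem AuxKer.conv {N : ℕ} {α β c₂ : ℝ} {Y : EuclideanSpace ℝ (Fin N) → ℝ → ℝ}
    (H : AuxKer N α β c₂ Y) {p q : ℝ} (hp : 1 < p) (hrp : p * ((N : ℝ) - 4 * β) = N)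
    (hq : 1 < q) (hq1 : (N : ℝ) < q * ((N : ℝ) - 2 * β)) (hqp : q < p) :
    ∃ A a : ℝ, 0 < A ∧ 0 < a ∧ ∀ τ : ℝ, 0 < τ → ∀ M : ℝ, 0 ≤ M →
      ∀ g : EuclideanSpace ℝ (Fin N) → ℝ≥0∞, Measurable g →
      ∫⁻ x, g x ≤ ENNReal.ofReal M →
      (∫⁻ x, g x ^ q) ^ (1 / q) ≤ ENNReal.ofReal M →
      (∫⁻ x, (∫⁻ y, ENNReal.ofReal (Y (x - y) τ) * g y) ^ p) ^ (1 / p) ≤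
        ENNReal.ofReal (A * (M * auxM a α τ)) := by
  have hβ := H.hβ
  have hα := H.hα
  have hNβ := H.hNβ
  have hp0 : 0 < p := by linarith
  have hq0 : 0 < q := by linarith
  have hN0 : (0 : ℝ) < N := by linarith
  have hpq : 1 / p < 1 / q := one_div_lt_one_div_of_lt hq0 hqp
  have hq1' : 1 / q < 1 := by rw [div_lt_one hq0]; exact hq
  have hp1' : 0 < 1 / p := by positivity
  have hs0 : 0 < 1 + 1 / p - 1 / q := by linarith
  obtain ⟨r, hr⟩ : ∃ r : ℝ, r = 1 / (1 + 1 / p - 1 / q) := ⟨_, rfl⟩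
  have hrinv : 1 / r = 1 + 1 / p - 1 / q := by rw [hr, one_div_one_div]
  have hr0 : 0 < r := by rw [hr]; positivity
  have hr1 : 1 ≤ r := by
    rw [hr, le_div_iff₀ hs0]; linarith
  have hrltp : r < p := by
    rw [← one_div_lt_one_div hp0 hr0, hrinv]; linarith
  have hr4 : r * ((N : ℝ) - 4 * β) < N := by
    have hN4 : (0 : ℝ) < (N : ℝ) - 4 * β := by linarith
    have := mul_lt_mul_of_pos_right hrltp hN4
    linarith
  have hY : 1 / r + 1 / q = 1 + 1 / p := by rw [hrinv]; ring
  obtain ⟨A1, hA1, h1⟩ := H.k1 hr1 hr4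
  obtain ⟨A2, hA2, h2⟩ := H.k2 hr1 hr4
  obtain ⟨A3, hA3, h3⟩ := H.k3 hp.le hrp
  set a := α - α * (N : ℝ) / (2 * β) + α * N / (2 * β) * (1 / r) with ha
  have ha0 : 0 < a := by
    have e1 : (N : ℝ) * (1 / p) = N - 4 * β := by
      rw [mul_one_div, div_eq_iff hp0.ne']; linarith
    have e2 : (N : ℝ) * (1 / q) < N - 2 * β := by
      rw [mul_one_div, div_lt_iff₀ hq0]; linarith
    have e3 : a = α / (2 * β) * (2 * β + N * (1 / p) - N * (1 / q)) := by
      rw [ha, hrinv]; field_simp; ring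
    rw [e3]
    have : 0 < 2 * β + N * (1 / p) - N * (1 / q) := by linarith
    positivity
  refine ⟨A1 + A2 + A3, a, by positivity, ha0, fun τ hτ M hM g hg hg1 hgq => ?_⟩
  have hmpos := (auxM_pos (a := a) (α := α) hτ).le
  have hYm : Measurable fun x => ENNReal.ofReal (Y x τ) := (H.meas τ).ennreal_ofReal
  by_cases hτ1 : τ < 1
  · have := aux_young volume hq.le hr1 hp.le hqp.le hrltp.le hY hYm hg
    refine this.trans ((mul_le_mul' (h1 τ hτ) hgq).trans ?_)
    rw [← ENNReal.ofReal_mul (by positivity)]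
    apply ENNReal.ofReal_le_ofReal
    have e : auxM a α τ = τ ^ (α - 1 - α * (N : ℝ) / (2 * β) + α * N / (2 * β) * (1 / r)) := by
      rw [auxM, if_pos hτ1]; congr 1; rw [ha]; ring
    rw [← e]
    have := mul_nonneg hM hmpos
    nlinarith
  · have hτ1' : 1 ≤ τ := not_lt.1 hτ1
    have hms : MeasurableSet {x : EuclideanSpace ℝ (Fin N) | ‖x‖ ≤ 1} :=
      measurableSet_le measurable_norm measurable_const
    set K1 : EuclideanSpace ℝ (Fin N) → ℝ≥0∞ :=
      fun x => if ‖x‖ ≤ 1 then ENNReal.ofReal (Y x τ) else 0 with hK1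
    set K2 : EuclideanSpace ℝ (Fin N) → ℝ≥0∞ :=
      fun x => if ‖x‖ ≤ 1 then 0 else ENNReal.ofReal (Y x τ) with hK2
    have hK1m : Measurable K1 := Measurable.ite hms hYm measurable_const
    have hK2m : Measurable K2 := Measurable.ite hms measurable_const hYm
    have hK : ∀ x, ENNReal.ofReal (Y x τ) = K1 x + K2 x := by
      intro x
      simp only [hK1, hK2]
      split_ifs <;> simp
    have hcm : ∀ K : EuclideanSpace ℝ (Fin N) → ℝ≥0∞, Measurable K →
        Measurable fun x => ∫⁻ y, K (x - y) * g y := by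
      intro K hKm
      have : Measurable (fun z : EuclideanSpace ℝ (Fin N) × EuclideanSpace ℝ (Fin N) =>
          K (z.1 - z.2) * g z.2) :=
        (hKm.comp (measurable_fst.sub measurable_snd)).mul (hg.comp measurable_snd)
      exact this.lintegral_prod_right'
    have hsum : ∀ x, ∫⁻ y, ENNReal.ofReal (Y (x - y) τ) * g y =
        ((fun x => ∫⁻ y, K1 (x - y) * g y) + (fun x => ∫⁻ y, K2 (x - y) * g y)) x := by
      intro x
      have hm1 : Measurable fun y => K1 (x - y) * g y :=
        (hK1m.comp (measurable_const.sub measurable_id)).mul hg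
      simp only [Pi.add_apply]
      rw [← lintegral_add_left hm1]
      refine lintegral_congr fun y => ?_
      rw [hK, add_mul]
    simp_rw [hsum]
    refine (ENNReal.lintegral_Lp_add_le (hcm K1 hK1m).aemeasurable (hcm K2 hK2m).aemeasurable
      hp.le).trans ?_
    have y1 := aux_young volume hq.le hr1 hp.le hqp.le hrltp.le hY hK1m hg
    have y2 := aux_young volume le_rfl hp.le hp.le hp.le le_rfl (by rw [div_one]; ring) hK2m hg
    simp only [ENNReal.rpow_one, div_one] at y2
    have z1 := y1.trans (mul_le_mul' (h2 τ hτ1') hgq)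
    have z2 := y2.trans (mul_le_mul' (h3 τ hτ1') hg1)
    refine (add_le_add z1 z2).trans ?_
    have hl : 0 ≤ Real.log τ := Real.log_nonneg hτ1'
    rw [← ENNReal.ofReal_mul (by positivity), ← ENNReal.ofReal_mul (by positivity),
      ← ENNReal.ofReal_add (by positivity) (by positivity)]
    apply ENNReal.ofReal_le_ofReal
    have e : auxM a α τ = τ ^ (-1 - α) * (1 + Real.log τ) := by rw [auxM, if_neg hτ1]
    rw [← e]
    have e' : τ ^ (-1 - α) ≤ auxM a α τ := by
      rw [e]
      have : 0 ≤ τ ^ (-1 - α) := by positivity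
      nlinarith
    have := mul_nonneg hM hmpos
    calc A2 * τ ^ (-1 - α) * M + A3 * auxM a α τ * M
        ≤ A2 * auxM a α τ * M + A3 * auxM a α τ * M := by gcongr
      _ ≤ _ := by nlinarith

theorem global_decay_pstar
    (N : ℕ) (α β : ℝ)
    (hα : 0 < α ∧ α < 1) (hβ : 0 < β ∧ β ≤ 1) (hN : 4 * β < (N : ℝ))
    (G : EuclideanSpace ℝ (Fin N) → ℝ)
    (hGmeas : Measurable G) (hGnonneg : ∀ ξ, 0 ≤ G ξ)
    (c₁ c₂ : ℝ) (hc₁ : 0 < c₁) (hc₂ : 0 < c₂)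
    (hGin : ∀ ξ : EuclideanSpace ℝ (Fin N), 0 < ‖ξ‖ → ‖ξ‖ ≤ 1 →
      c₁ * ‖ξ‖ ^ (4 * β - (N : ℝ)) ≤ G ξ ∧ G ξ ≤ c₂ * ‖ξ‖ ^ (4 * β - (N : ℝ)))
    (hGout : ∀ ξ : EuclideanSpace ℝ (Fin N), 1 ≤ ‖ξ‖ →
      c₁ * ‖ξ‖ ^ (-((N : ℝ) + 2 * β)) ≤ G ξ ∧ G ξ ≤ c₂ * ‖ξ‖ ^ (-((N : ℝ) + 2 * β)))
    (Y : EuclideanSpace ℝ (Fin N) → ℝ → ℝ)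
    (hY : ∀ x t, Y x t = t ^ (α - 1 - α * (N : ℝ) / (2 * β)) * G ((t ^ (-(α / (2 * β)))) • x))
    (f : EuclideanSpace ℝ (Fin N) → ℝ → ℝ)
    (hfmeas : Measurable (Function.uncurry f))
    (γ : ℝ) (C₀ : ℝ) (hC₀ : 0 < C₀)
    (hf1 : ∀ t : ℝ, 0 ≤ t →
      eLpNorm (fun y => f y t) 1 volume ≤ ENNReal.ofReal (C₀ * (1 + t) ^ (-γ)))
    (R₀ C₁ : ℝ) (hR₀ : 0 < R₀) (hC₁ : 0 < C₁)
    (hfdec : ∀ (x : EuclideanSpace ℝ (Fin N)) (t : ℝ), R₀ ≤ ‖x‖ → 0 ≤ t →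
      |f x t| ≤ C₁ * ‖x‖ ^ (-(N : ℝ)) * (1 + t) ^ (-γ))
    (q : ℝ) (hq : q > (N : ℝ) / (2 * β + (N : ℝ) / ((N : ℝ) / ((N : ℝ) - 4 * β))))
    (hfq : ∀ t : ℝ, 0 ≤ t →
      eLpNorm (fun y => f y t) (ENNReal.ofReal q) volume ≤ ENNReal.ofReal (C₀ * (1 + t) ^ (-γ)))
    (u : EuclideanSpace ℝ (Fin N) → ℝ → ℝ)
    (hu : ∀ x t, u x t = ∫ s in Set.Ioc (0:ℝ) t, ∫ y, Y (x - y) (t - s) * f y s) :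
    ∃ C : ℝ, 0 < C ∧ ∀ t : ℝ, 2 ≤ t →
      (γ < 1 + α →
        eLpNorm (fun x => u x t) (ENNReal.ofReal ((N : ℝ) / ((N : ℝ) - 4 * β))) volume ≤
          ENNReal.ofReal (C * t ^ (-γ))) ∧
      (1 + α ≤ γ →
        eLpNorm (fun x => u x t) (ENNReal.ofReal ((N : ℝ) / ((N : ℝ) - 4 * β))) volume ≤
          ENNReal.ofReal (C * t ^ (-(1 + α)) * Real.log t)) := by
  obtain ⟨hα0, hα1⟩ := hα
  obtain ⟨hβ0, hβ1⟩ := hβ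
  have hN0 : (0 : ℝ) < N := by linarith
  have hNn : 0 < N := by exact_mod_cast hN0
  have hN4 : (0 : ℝ) < (N : ℝ) - 4 * β := by linarith
  have hN2 : (0 : ℝ) < (N : ℝ) - 2 * β := by linarith
  obtain ⟨p, hpdef⟩ : ∃ p : ℝ, p = (N : ℝ) / ((N : ℝ) - 4 * β) := ⟨_, rfl⟩
  rw [← hpdef] at hq ⊢
  have hrp : p * ((N : ℝ) - 4 * β) = N := by rw [hpdef]; field_simp
  have hp : 1 < p := by rw [hpdef, lt_div_iff₀ hN4]; linarith
  have hp0 : 0 < p := by linarith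
  have hNp : (N : ℝ) / p = N - 4 * β := by rw [div_eq_iff hp0.ne']; linarith
  have hqc : (N : ℝ) / (2 * β + (N : ℝ) / p) = N / (N - 2 * β) := by
    rw [hNp]; congr 1; ring
  rw [hqc] at hq
  have hqc1 : 1 < (N : ℝ) / (N - 2 * β) := by rw [lt_div_iff₀ hN2]; linarith
  have hqcp : (N : ℝ) / (N - 2 * β) < p := by
    rw [hpdef]; exact div_lt_div_of_pos_left hN0 hN4 (by linarith)
  have hq0 : 0 < q := by linarith
  obtain ⟨q', hq'1, hq'2⟩ := exists_between (lt_min hq hqcp)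
  have hq'q : q' < q := hq'2.trans_le (min_le_left _ _)
  have hq'p : q' < p := hq'2.trans_le (min_le_right _ _)
  have hq'N : (N : ℝ) < q' * ((N : ℝ) - 2 * β) := by rwa [div_lt_iff₀ hN2] at hq'1
  have hYm : Measurable (Function.uncurry Y) := by
    have : Function.uncurry Y = fun z : EuclideanSpace ℝ (Fin N) × ℝ =>
        z.2 ^ (α - 1 - α * (N : ℝ) / (2 * β)) * G ((z.2 ^ (-(α / (2 * β)))) • z.1) := by
      funext z; exact hY z.1 z.2
    rw [this]
    have h1 : Measurable fun z : EuclideanSpace ℝ (Fin N) × ℝ =>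
        z.2 ^ (α - 1 - α * (N : ℝ) / (2 * β)) := by fun_prop
    have h2 : Measurable fun z : EuclideanSpace ℝ (Fin N) × ℝ =>
        (z.2 ^ (-(α / (2 * β)))) • z.1 := by fun_prop
    exact h1.mul (hGmeas.comp h2)
  have hYnn : ∀ x τ, 0 < τ → 0 ≤ Y x τ := by
    intro x τ hτ
    rw [hY]
    have := hGnonneg ((τ ^ (-(α / (2 * β)))) • x)
    positivity
  have H : AuxKer N α β c₂ Y := by
    refine ⟨hNn, hα0, hβ0, hN, hc₂, fun τ => hYm.comp measurable_prodMk_right, ?_⟩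
    intro x τ hx hτ
    rw [hY]
    have hc0 : 0 < τ ^ (-(α / (2 * β))) := Real.rpow_pos_of_pos hτ _
    set ξ := (τ ^ (-(α / (2 * β)))) • x with hξ
    have hξ0 : 0 < ‖ξ‖ := by
      rw [norm_pos_iff, hξ]
      exact smul_ne_zero hc0.ne' hx
    have hGb : G ξ ≤ c₂ * auxRad N β ‖ξ‖ := by
      unfold auxRad
      split_ifs with h
      · exact (hGin ξ hξ0 h).2
      · exact (hGout ξ (not_le.1 h).le).2
    calc τ ^ (α - 1 - α * (N : ℝ) / (2 * β)) * G ξ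
        ≤ τ ^ (α - 1 - α * (N : ℝ) / (2 * β)) * (c₂ * auxRad N β ‖ξ‖) := by gcongr
      _ = _ := by ring
  obtain ⟨A, a, hA, ha, hconv⟩ := H.conv hp hrp (hqc1.trans hq'1) hq'N hq'p
  obtain ⟨C, hC, hT⟩ := aux_time (γ := γ) ha hα0
  have hmain : ∀ t : ℝ, 2 ≤ t → eLpNorm (fun x => u x t) (ENNReal.ofReal p) volume ≤
      ENNReal.ofReal (A * C₀) *
        ∫⁻ s in Ioo (0 : ℝ) t, ENNReal.ofReal ((1 + s) ^ (-γ) * auxM a α (t - s)) := by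
    intro t ht
    set v : EuclideanSpace ℝ (Fin N) → ℝ → ℝ≥0∞ := fun x s =>
      ∫⁻ y, ENNReal.ofReal (Y (x - y) (t - s)) * ‖f y s‖ₑ with hv
    have hvm : Measurable (Function.uncurry v) := by
      have hm : Measurable (fun z : (EuclideanSpace ℝ (Fin N) × ℝ) × EuclideanSpace ℝ (Fin N) =>
          ENNReal.ofReal (Y (z.1.1 - z.2) (t - z.1.2)) * ‖f z.2 z.1.2‖ₑ) := by
        have m1 : Measurable (fun z : (EuclideanSpace ℝ (Fin N) × ℝ) × EuclideanSpace ℝ (Fin N) =>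
          Y (z.1.1 - z.2) (t - z.1.2)) :=
          hYm.comp (g := Function.uncurry Y) (by fun_prop :
            Measurable fun z : (EuclideanSpace ℝ (Fin N) × ℝ) × EuclideanSpace ℝ (Fin N) =>
              (z.1.1 - z.2, t - z.1.2))
        have m2 : Measurable (fun z : (EuclideanSpace ℝ (Fin N) × ℝ) × EuclideanSpace ℝ (Fin N) =>
          f z.2 z.1.2) :=
          hfmeas.comp (g := Function.uncurry f) (by fun_prop :
            Measurable fun z : (EuclideanSpace ℝ (Fin N) × ℝ) × EuclideanSpace ℝ (Fin N) =>
              (z.2, z.1.2))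
        exact m1.ennreal_ofReal.mul m2.enorm
      exact hm.lintegral_prod_right'
    have hub : ∀ x, ‖u x t‖ₑ ≤ ∫⁻ s in Ioo (0 : ℝ) t, v x s := by
      intro x
      rw [hu, integral_Ioc_eq_integral_Ioo]
      refine (enorm_integral_le_lintegral_enorm _).trans ?_
      refine setLIntegral_mono' measurableSet_Ioo fun s hs => ?_
      refine (enorm_integral_le_lintegral_enorm _).trans (le_of_eq (lintegral_congr fun y => ?_))
      rw [enorm_mul, Real.enorm_of_nonneg (hYnn _ _ (sub_pos.2 hs.2))]
    have hpe : ENNReal.ofReal p ≠ 0 := by simpa using hp0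
    rw [eLpNorm_eq_lintegral_rpow_enorm_toReal hpe ENNReal.ofReal_ne_top,
      ENNReal.toReal_ofReal hp0.le]
    have hMm0 : Measurable fun s : ℝ => (1 + s) ^ (-γ) * auxM a α (t - s) :=
      (by fun_prop : Measurable fun s : ℝ => (1 + s) ^ (-γ)).mul
        ((auxM_meas a α).comp (measurable_const.sub measurable_id))
    have hAC : 0 < A * C₀ := by positivity
    rw [← lintegral_const_mul _ hMm0.ennreal_ofReal]
    refine le_trans (b := (∫⁻ x, (∫⁻ s in Ioo (0 : ℝ) t, v x s) ^ p) ^ (1 / p)) ?_ ?_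
    · gcongr with x
      exact hub x
    · refine aux_mink volume (volume.restrict (Ioo 0 t)) hp.le hvm
        (measurable_const.mul hMm0.ennreal_ofReal) ?_ ?_ ?_
      · filter_upwards [ae_restrict_mem measurableSet_Ioo] with s hs
        have h1 := auxM_pos (a := a) (α := α) (sub_pos.2 hs.2)
        have h2 := hs.1
        have h3 : 0 < (1 + s) ^ (-γ) := by positivity
        rw [← ENNReal.ofReal_mul hAC.le]
        exact (ENNReal.ofReal_pos.2 (by positivity)).ne'
      · exact ae_of_all _ fun s => ENNReal.mul_ne_top ENNReal.ofReal_ne_top ENNReal.ofReal_ne_top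
      · filter_upwards [ae_restrict_mem measurableSet_Ioo] with s hs
        have h2 := hs.1
        have hM0 : 0 ≤ C₀ * (1 + s) ^ (-γ) := by positivity
        have hgm : Measurable fun y => ‖f y s‖ₑ :=
          (hfmeas.comp measurable_prodMk_right : Measurable fun y => f y s).enorm
        have hg1 := hf1 s h2.le
        rw [eLpNorm_one_eq_lintegral_enorm] at hg1
        have hgq := hfq s h2.le
        rw [eLpNorm_eq_lintegral_rpow_enorm_toReal (by simpa using hq0) ENNReal.ofReal_ne_top,
          ENNReal.toReal_ofReal hq0.le] at hgq
        have hgq' := aux_interp volume (hqc1.trans hq'1) hq'q hgm hg1 hgq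
        refine (hconv (t - s) (sub_pos.2 hs.2) _ hM0 _ hgm hg1 hgq').trans (le_of_eq ?_)
        rw [← ENNReal.ofReal_mul hAC.le]
        congr 1
        ring
  have hAC : 0 < A * C₀ := by positivity
  refine ⟨A * C₀ * C, by positivity, fun t ht => ⟨fun h => ?_, fun h => ?_⟩⟩
  · refine (hmain t ht).trans ((mul_le_mul_right ((hT t ht).1 h) _).trans (le_of_eq ?_))
    rw [← ENNReal.ofReal_mul hAC.le]
    congr 1
    ring
  · refine (hmain t ht).trans ((mul_le_mul_right ((hT t ht).2 h) _).trans (le_of_eq ?_))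
    rw [← ENNReal.ofReal_mul hAC.le]
    congr 1
    ring
end

section
/- Let p ∈ (p_*, ∞], γ ∈ ℝ, and suppose: ‖f(·,t)‖_{L^1(ℝ^N)} ≤ C₀ (1+t)^{−γ} for all t ≥ 0; there are R₀, C₁ > 0 with |f(x,t)| ≤ C₁ |x|^{−N} (1+t)^{−γ} for all |x| ≥ R₀ and t ≥ 0; and ‖f(·,t)‖_{L^q(ℝ^N)} ≤ C₀ (1+t)^{−γ} for all t ≥ 0, for some q > q_c(p) := N/(2β + N/p). Then there is a constant C such that the mild solution u satisfies, for all t ≥ 2: ‖u(·,t)‖_{L^p(ℝ^N)} ≤ C t^{−γ} if γ ≤ 1+α, and ‖u(·,t)‖_{L^p(ℝ^N)} ≤ C t^{−(1+α)} if γ ≥ 1+α. -/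
open MeasureTheory Real Set Filter
open scoped ENNReal Pointwise

lemma aux_holder {N : ℕ} (K g : EuclideanSpace ℝ (Fin N) → ℝ≥0∞) (hK : Measurable K)
    (hg : Measurable g) (r m P : ℝ) (hr : 1 ≤ r) (hm : 1 ≤ m) (hP : 0 ≤ P)
    (h : 1 / r + 1 / m = 1 + P) (x : EuclideanSpace ℝ (Fin N)) :
    ∫⁻ y, K (x - y) * g y ≤ (∫⁻ y, K (x - y) ^ r * g y ^ m) ^ P *
      ((∫⁻ y, K y ^ r) ^ (1 / r - P) * (∫⁻ y, g y ^ m) ^ (1 / m - P)) := by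
  have hr0 : 0 < r := by linarith
  have hm0 : 0 < m := by linarith
  have hr1 : 1 / r ≤ 1 := by rw [div_le_one hr0]; exact hr
  have hm1 : 1 / m ≤ 1 := by rw [div_le_one hm0]; exact hm
  have e1 : 0 ≤ 1 / r - P := by linarith
  have e2 : 0 ≤ 1 / m - P := by linarith
  have hKx : Measurable (fun y => K (x - y)) := hK.comp (measurable_const.sub measurable_id)
  have key := ENNReal.lintegral_prod_norm_pow_le (μ := (volume : Measure (EuclideanSpace ℝ (Fin N))))
    (Finset.univ : Finset (Fin 3))
    (f := ![fun y => K (x - y) ^ r * g y ^ m, fun y => K (x - y) ^ r, fun y => g y ^ m])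
    (p := ![P, 1 / r - P, 1 / m - P])
    (by
      intro i _
      fin_cases i
      · exact ((hKx.pow_const r).mul (hg.pow_const m)).aemeasurable
      · exact (hKx.pow_const r).aemeasurable
      · exact (hg.pow_const m).aemeasurable)
    (by simp [Fin.sum_univ_three] at h ⊢; linarith)
    (by
      intro i _
      fin_cases i
      · exact hP
      · exact e1
      · exact e2)
  simp only [Fin.prod_univ_three, Matrix.cons_val_zero, Matrix.cons_val_one, Matrix.cons_val] at key
  have htr : ∫⁻ y, K (x - y) ^ r = ∫⁻ y, K y ^ r :=
    lintegral_sub_left_eq_self (fun y => K y ^ r) x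
  rw [htr, mul_assoc] at key
  refine le_trans (le_of_eq ?_) key
  refine lintegral_congr fun y => ?_
  rw [ENNReal.mul_rpow_of_nonneg _ _ hP]
  have a1 : (K (x - y) ^ r) ^ P * (K (x - y) ^ r) ^ (1 / r - P) = K (x - y) := by
    rw [← ENNReal.rpow_add_of_nonneg _ _ hP e1, ← ENNReal.rpow_mul]
    have : r * (P + (1 / r - P)) = 1 := by field_simp; ring
    rw [this, ENNReal.rpow_one]
  have a2 : (g y ^ m) ^ P * (g y ^ m) ^ (1 / m - P) = g y := by
    rw [← ENNReal.rpow_add_of_nonneg _ _ hP e2, ← ENNReal.rpow_mul]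
    have : m * (P + (1 / m - P)) = 1 := by field_simp; ring
    rw [this, ENNReal.rpow_one]
  calc K (x - y) * g y = ((K (x - y) ^ r) ^ P * (K (x - y) ^ r) ^ (1 / r - P)) *
      ((g y ^ m) ^ P * (g y ^ m) ^ (1 / m - P)) := by rw [a1, a2]
    _ = _ := by ring

lemma aux_young_s18 {N : ℕ} (K g : EuclideanSpace ℝ (Fin N) → ℝ≥0∞) (hK : Measurable K)
    (hg : Measurable g) (r m : ℝ) (p : ℝ≥0∞) (hp0 : p ≠ 0) (hr : 1 ≤ r) (hm : 1 ≤ m)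
    (h : 1 / r + 1 / m = 1 + 1 / p.toReal) :
    eLpNorm (fun x => ∫⁻ y, K (x - y) * g y) p volume ≤
      (∫⁻ y, K y ^ r) ^ (1 / r) * (∫⁻ y, g y ^ m) ^ (1 / m) := by
  have hr0 : 0 < r := by linarith
  have hm0 : 0 < m := by linarith
  have hr1 : 1 / r ≤ 1 := by rw [div_le_one hr0]; exact hr
  have hm1 : 1 / m ≤ 1 := by rw [div_le_one hm0]; exact hm
  by_cases hpt : p = ⊤
  · subst hpt
    simp only [eLpNorm_exponent_top]
    refine essSup_le_of_ae_le _ (Eventually.of_forall fun x => ?_)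
    have := aux_holder K g hK hg r m 0 hr hm le_rfl (by simpa using h) x
    simpa using this
  · have hP : 0 < p.toReal := ENNReal.toReal_pos hp0 hpt
    have hP' : 0 ≤ 1 / p.toReal := by positivity
    have e1 : 0 ≤ 1 / r - 1 / p.toReal := by linarith
    have e2 : 0 ≤ 1 / m - 1 / p.toReal := by linarith
    rw [eLpNorm_eq_lintegral_rpow_enorm_toReal hp0 hpt]
    set A := ∫⁻ y, K y ^ r with hA
    set B := ∫⁻ y, g y ^ m with hB
    set D := A ^ (1 / r - 1 / p.toReal) * B ^ (1 / m - 1 / p.toReal) with hD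
    have step : ∫⁻ x, ‖∫⁻ y, K (x - y) * g y‖ₑ ^ p.toReal ≤ A * B * D ^ p.toReal := by
      calc ∫⁻ x, ‖∫⁻ y, K (x - y) * g y‖ₑ ^ p.toReal
          ≤ ∫⁻ x, (∫⁻ y, K (x - y) ^ r * g y ^ m) * D ^ p.toReal := by
            refine lintegral_mono fun x => ?_
            have := aux_holder K g hK hg r m (1 / p.toReal) hr hm hP' h x
            have := ENNReal.rpow_le_rpow this hP.le
            rw [ENNReal.mul_rpow_of_nonneg _ _ hP.le, ← ENNReal.rpow_mul,
              one_div_mul_cancel hP.ne', ENNReal.rpow_one] at this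
            exact this
        _ = (∫⁻ x, ∫⁻ y, K (x - y) ^ r * g y ^ m) * D ^ p.toReal := by
            apply lintegral_mul_const
            apply Measurable.lintegral_prod_right
            fun_prop
        _ = A * B * D ^ p.toReal := by
            congr 1
            rw [lintegral_lintegral_swap (by fun_prop)]
            rw [hB, ← lintegral_const_mul _ (hg.pow_const m)]
            refine lintegral_congr fun y => ?_
            rw [lintegral_mul_const _ (by fun_prop)]
            congr 1
            exact lintegral_sub_right_eq_self (fun y => K y ^ r) y
    refine (ENNReal.rpow_le_rpow step hP').trans (le_of_eq ?_)
    rw [ENNReal.mul_rpow_of_nonneg _ _ hP', ← ENNReal.rpow_mul, mul_one_div_cancel hP.ne',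
      ENNReal.rpow_one, ENNReal.mul_rpow_of_nonneg _ _ hP', hD]
    calc _ = (A ^ (1 / p.toReal) * A ^ (1 / r - 1 / p.toReal)) *
        (B ^ (1 / p.toReal) * B ^ (1 / m - 1 / p.toReal)) := by ring
      _ = _ := by
        rw [← ENNReal.rpow_add_of_nonneg _ _ hP' e1, ← ENNReal.rpow_add_of_nonneg _ _ hP' e2]
        simp

/-- Jensen / Minkowski. -/
lemma aux_jensen {N : ℕ} (ν : Measure ℝ) [SFinite ν] (h : EuclideanSpace ℝ (Fin N) → ℝ → ℝ≥0∞)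
    (hh : Measurable (Function.uncurry h)) (m : ℝ) (hm : 1 ≤ m) (A : ℝ≥0∞)
    (hA : ∀ᵐ s ∂ν, ∫⁻ y, h y s ^ m ≤ A) :
    ∫⁻ y, (∫⁻ s, h y s ∂ν) ^ m ≤ ν univ ^ m * A := by
  have hm0 : 0 < m := by linarith
  have hm1 : 1 / m ≤ 1 := by rw [div_le_one hm0]; exact hm
  have hmeas : ∀ y, Measurable (h y) := fun y => hh.comp measurable_prodMk_left
  have pt : ∀ y, (∫⁻ s, h y s ∂ν) ^ m ≤ (∫⁻ s, h y s ^ m ∂ν) * ν univ ^ (m - 1) := by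
    intro y
    have key := ENNReal.lintegral_prod_norm_pow_le (μ := ν)
      (Finset.univ : Finset (Fin 2))
      (f := ![fun s => h y s ^ m, fun s => 1])
      (p := ![1 / m, 1 - 1 / m])
      (by
        intro i _
        fin_cases i
        · exact ((hmeas y).pow_const m).aemeasurable
        · exact measurable_const.aemeasurable)
      (by simp [Fin.sum_univ_two])
      (by
        intro i _
        fin_cases i
        · simp; linarith
        · simpa using hm1)
    simp only [Fin.prod_univ_two, Matrix.cons_val_zero, Matrix.cons_val_one, ENNReal.one_rpow,
      mul_one, lintegral_one, ← ENNReal.rpow_mul, mul_one_div_cancel hm0.ne', ENNReal.rpow_one] at key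
    have := ENNReal.rpow_le_rpow key hm0.le
    rw [ENNReal.mul_rpow_of_nonneg _ _ hm0.le, ← ENNReal.rpow_mul, ← ENNReal.rpow_mul,
      one_div_mul_cancel hm0.ne', ENNReal.rpow_one] at this
    have e : (1 - 1 / m) * m = m - 1 := by field_simp
    rwa [e] at this
  calc ∫⁻ y, (∫⁻ s, h y s ∂ν) ^ m ≤ ∫⁻ y, (∫⁻ s, h y s ^ m ∂ν) * ν univ ^ (m - 1) :=
        lintegral_mono pt
    _ = (∫⁻ y, ∫⁻ s, h y s ^ m ∂ν) * ν univ ^ (m - 1) := by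
        apply lintegral_mul_const
        apply Measurable.lintegral_prod_right
        exact hh.pow_const m
    _ = (∫⁻ s, (∫⁻ y, h y s ^ m) ∂ν) * ν univ ^ (m - 1) := by
        rw [lintegral_lintegral_swap]
        exact (hh.pow_const m).aemeasurable
    _ ≤ (∫⁻ s, A ∂ν) * ν univ ^ (m - 1) := by
        gcongr ?_ * _
        exact lintegral_mono_ae hA
    _ = ν univ ^ m * A := by
        rw [lintegral_const, mul_assoc]
        have : ν univ * ν univ ^ (m - 1) = ν univ ^ m := by
          conv_lhs => rw [← ENNReal.rpow_one (ν univ)]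
          rw [← ENNReal.rpow_mul, ← ENNReal.rpow_add_of_nonneg _ _ (by norm_num) (by linarith)]
          congr 1; ring
        rw [this, mul_comm]

/-- inner kernel -/
lemma aux_K1 {N : ℕ} (hN : 0 < N) (a r : ℝ) (hr : 1 ≤ r) (ha : a * r < N) :
    ∫⁻ x : EuclideanSpace ℝ (Fin N),
      (ENNReal.ofReal ((Metric.ball 0 1).indicator (fun x => ‖x‖ ^ (-a)) x)) ^ r < ⊤ := by
  have h1 : IntegrableOn (fun x : EuclideanSpace ℝ (Fin N) => ‖x‖ ^ (-(a * r)))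
      (Metric.ball 0 1) := by
    refine integrableOn_ball_of_norm_le_rpow (C := 1) (α := a * r) (by rw [finrank_euclideanSpace_fin]; exact hN)
      (by simpa using ha) (Eventually.of_forall fun x => ?_)
      (measurable_norm.pow_const _).aestronglyMeasurable
    rw [one_mul, Real.norm_of_nonneg (by positivity)]
  rw [← integrable_indicator_iff measurableSet_ball] at h1
  have h2 := h1.lintegral_lt_top
  refine lt_of_le_of_lt (lintegral_mono fun x => ?_) h2
  rw [ENNReal.ofReal_rpow_of_nonneg (indicator_nonneg (fun x _ => by positivity) _) (by linarith)]
  apply ENNReal.ofReal_le_ofReal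
  by_cases hx : x ∈ Metric.ball (0 : EuclideanSpace ℝ (Fin N)) 1
  · simp only [indicator_of_mem hx]
    rw [← Real.rpow_mul (norm_nonneg _), neg_mul]
  · simp only [indicator_of_notMem hx]
    rw [Real.zero_rpow (by linarith)]

lemma aux_K2 {N : ℕ} (b r : ℝ) (hr : 1 ≤ r) (hb0 : 0 < b) (hb : N < b * r) :
    ∫⁻ x : EuclideanSpace ℝ (Fin N),
      (ENNReal.ofReal ((Metric.ball 0 1)ᶜ.indicator (fun x => ‖x‖ ^ (-b)) x)) ^ r < ⊤ := by
  have h1 : Integrable (fun x : EuclideanSpace ℝ (Fin N) => (2:ℝ) ^ (b * r) * (1 + ‖x‖) ^ (-(b * r))) :=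
    (integrable_one_add_norm (by simpa using hb)).const_mul _
  have h2 := h1.lintegral_lt_top
  refine lt_of_le_of_lt (lintegral_mono fun x => ?_) h2
  rw [ENNReal.ofReal_rpow_of_nonneg (indicator_nonneg (fun x _ => by positivity) _) (by linarith)]
  apply ENNReal.ofReal_le_ofReal
  by_cases hx : x ∈ (Metric.ball (0 : EuclideanSpace ℝ (Fin N)) 1)ᶜ
  · simp only [indicator_of_mem hx]
    have hx1 : 1 ≤ ‖x‖ := by simpa using hx
    have hbr : 0 < b * r := by positivity
    rw [← Real.rpow_mul (norm_nonneg _), neg_mul, Real.rpow_neg (by linarith), Real.rpow_neg (by linarith),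
      ← div_eq_mul_inv, ← one_div, div_le_div_iff₀ (by positivity) (by positivity), one_mul,
      ← Real.mul_rpow (by norm_num) (by linarith)]
    exact Real.rpow_le_rpow (by linarith) (by linarith) hbr.le
  · simp only [indicator_of_notMem hx]
    rw [Real.zero_rpow (by linarith)]
    positivity

/-- time kernel -/
noncomputable def auxk (e α τ : ℝ) : ℝ :=
  if 0 < τ then (if τ ≤ 1 then τ ^ (e - 1) else τ ^ (-(1 + α))) else 0

lemma auxk_nonneg (e α τ : ℝ) : 0 ≤ auxk e α τ := by
  unfold auxk
  split_ifs <;> positivity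

lemma auxk_meas (e α : ℝ) : Measurable (auxk e α) := by
  unfold auxk
  refine Measurable.ite measurableSet_Ioi (Measurable.ite measurableSet_Iic ?_ ?_) measurable_const
  · exact measurable_id.pow_const _
  · exact measurable_id.pow_const _

lemma auxk_int (e α : ℝ) (he : 0 < e) (hα : 0 < α) :
    ∫⁻ τ, ENNReal.ofReal (auxk e α τ) < ⊤ := by
  have h1 : IntegrableOn (fun τ : ℝ => τ ^ (e - 1)) (Ioc 0 1) :=
    (intervalIntegrable_iff_integrableOn_Ioc_of_le zero_le_one).1
      (intervalIntegral.intervalIntegrable_rpow' (by linarith))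
  have h2 : IntegrableOn (fun τ : ℝ => τ ^ (-(1 + α))) (Ioi 1) :=
    integrableOn_Ioi_rpow_of_lt (by linarith) one_pos
  have h3 : Integrable (fun τ => (Ioc (0:ℝ) 1).indicator (fun τ : ℝ => τ ^ (e - 1)) τ
      + (Ioi (1:ℝ)).indicator (fun τ : ℝ => τ ^ (-(1 + α))) τ) :=
    ((integrable_indicator_iff measurableSet_Ioc).2 h1).add
      ((integrable_indicator_iff measurableSet_Ioi).2 h2)
  refine lt_of_le_of_lt (lintegral_mono fun τ => ?_) h3.lintegral_lt_top
  apply ENNReal.ofReal_le_ofReal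
  unfold auxk
  split_ifs with h h'
  · rw [indicator_of_mem (show τ ∈ Ioc (0:ℝ) 1 from ⟨h, h'⟩), indicator_of_notMem (by simpa using h')]
    simp
  · rw [indicator_of_notMem (by simp only [mem_Ioc]; tauto),
      indicator_of_mem (show τ ∈ Ioi (1:ℝ) from not_le.1 h')]
    simp
  · exact add_nonneg (indicator_nonneg (fun x hx => Real.rpow_nonneg hx.1.le _) _)
      (indicator_nonneg (fun x hx => Real.rpow_nonneg (zero_le_one.trans (le_of_lt hx)) _) _)

lemma aux_W (e α γ : ℝ) (he : 0 < e) (hα : 0 < α) (hγ : γ ≤ 1 + α) :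
    ∃ C : ℝ, 0 < C ∧ ∀ t : ℝ, 2 ≤ t →
      ∫⁻ s in Ioc (0:ℝ) t, ENNReal.ofReal (auxk e α (t - s)) * ENNReal.ofReal ((1 + s) ^ (-γ))
        ≤ ENNReal.ofReal (C * t ^ (-γ)) := by
  have hJ : ∫⁻ s : ℝ, ENNReal.ofReal ((1 + ‖s‖) ^ (-(1 + α))) < ⊤ :=
    finite_integral_one_add_norm (by simpa using hα)
  have hI := auxk_int e α he hα
  set J := ∫⁻ s : ℝ, ENNReal.ofReal ((1 + ‖s‖) ^ (-(1 + α)))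
  set I := ∫⁻ τ, ENNReal.ofReal (auxk e α τ)
  refine ⟨2 ^ (1 + α) * J.toReal + 2 ^ |γ| * I.toReal + 1, by positivity, fun t ht => ?_⟩
  have ht0 : 0 < t := by linarith
  have pt : ∀ s ∈ Ioc (0:ℝ) t, ENNReal.ofReal (auxk e α (t - s)) * ENNReal.ofReal ((1 + s) ^ (-γ)) ≤
      ENNReal.ofReal (t ^ (-γ)) * (ENNReal.ofReal (2 ^ (1 + α)) *
        ENNReal.ofReal ((1 + ‖s‖) ^ (-(1 + α))) + ENNReal.ofReal (2 ^ |γ|) *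
        ENNReal.ofReal (auxk e α (t - s))) := by
    rintro s ⟨hs0, hst⟩
    have hk := auxk_nonneg e α (t - s)
    rw [Real.norm_of_nonneg hs0.le, ← ENNReal.ofReal_mul hk, ← ENNReal.ofReal_mul (by positivity),
      ← ENNReal.ofReal_mul (by positivity), ← ENNReal.ofReal_add (by positivity) (by positivity),
      ← ENNReal.ofReal_mul (by positivity)]
    apply ENNReal.ofReal_le_ofReal
    by_cases hs : s < t / 2
    · have h1 : auxk e α (t - s) ≤ 2 ^ (1 + α) * t ^ (-(1 + α)) := by
        have a1 : auxk e α (t - s) = (t - s) ^ (-(1 + α)) := by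
          unfold auxk
          rw [if_pos (by linarith), if_neg (by linarith)]
        rw [a1]
        calc (t - s) ^ (-(1 + α)) ≤ (t / 2) ^ (-(1 + α)) :=
              Real.rpow_le_rpow_of_nonpos (by linarith) (by linarith) (by linarith)
          _ = 2 ^ (1 + α) * t ^ (-(1 + α)) := by
              rw [Real.div_rpow ht0.le (by norm_num), Real.rpow_neg (by norm_num : (0:ℝ) ≤ 2)]
              field_simp
      have h2 : (1 + s) ^ (-γ) ≤ (1 + s) ^ (-(1 + α)) * t ^ (1 + α - γ) := by
        have : -γ = -(1 + α) + (1 + α - γ) := by ring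
        rw [this, Real.rpow_add (by linarith)]
        gcongr
        linarith
      calc auxk e α (t - s) * (1 + s) ^ (-γ)
          ≤ (2 ^ (1 + α) * t ^ (-(1 + α))) * ((1 + s) ^ (-(1 + α)) * t ^ (1 + α - γ)) := by
            gcongr
        _ = (t ^ (-(1 + α)) * t ^ (1 + α - γ)) * (2 ^ (1 + α) * (1 + s) ^ (-(1 + α))) := by ring
        _ = t ^ (-γ) * (2 ^ (1 + α) * (1 + s) ^ (-(1 + α))) := by
            rw [← Real.rpow_add ht0]; congr 2; ring
        _ ≤ _ := by
            gcongr
            have : 0 ≤ 2 ^ |γ| * auxk e α (t - s) := by positivity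
            linarith
    · have h2 : (1 + s) ^ (-γ) ≤ t ^ (-γ) * 2 ^ |γ| := by
        rcases le_total 0 γ with h | h
        · rw [abs_of_nonneg h]
          calc (1 + s) ^ (-γ) ≤ (t / 2) ^ (-γ) :=
              Real.rpow_le_rpow_of_nonpos (by linarith) (by linarith) (by linarith)
          _ = t ^ (-γ) * 2 ^ γ := by
              rw [Real.div_rpow ht0.le (by norm_num), Real.rpow_neg (by norm_num : (0:ℝ) ≤ 2)]
              field_simp
        · rw [abs_of_nonpos h, ← Real.mul_rpow ht0.le (by norm_num)]
          exact Real.rpow_le_rpow (by linarith) (by linarith) (by linarith)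
      calc auxk e α (t - s) * (1 + s) ^ (-γ) ≤ auxk e α (t - s) * (t ^ (-γ) * 2 ^ |γ|) := by gcongr
        _ = t ^ (-γ) * (2 ^ |γ| * auxk e α (t - s)) := by ring
        _ ≤ _ := by
            gcongr
            have : 0 ≤ 2 ^ (1 + α) * (1 + s) ^ (-(1 + α)) := by positivity
            linarith
  have mk : Measurable fun s : ℝ => ENNReal.ofReal (auxk e α (t - s)) :=
    ((auxk_meas e α).comp (measurable_const.sub measurable_id)).ennreal_ofReal
  have mj : Measurable fun s : ℝ => ENNReal.ofReal ((1 + ‖s‖) ^ (-(1 + α))) :=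
    ((measurable_const.add measurable_norm).pow_const _).ennreal_ofReal
  calc _ ≤ ∫⁻ s in Ioc (0:ℝ) t, ENNReal.ofReal (t ^ (-γ)) * (ENNReal.ofReal (2 ^ (1 + α)) *
        ENNReal.ofReal ((1 + ‖s‖) ^ (-(1 + α))) + ENNReal.ofReal (2 ^ |γ|) *
        ENNReal.ofReal (auxk e α (t - s))) := setLIntegral_mono' measurableSet_Ioc pt
    _ ≤ ∫⁻ s, ENNReal.ofReal (t ^ (-γ)) * (ENNReal.ofReal (2 ^ (1 + α)) *
        ENNReal.ofReal ((1 + ‖s‖) ^ (-(1 + α))) + ENNReal.ofReal (2 ^ |γ|) *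
        ENNReal.ofReal (auxk e α (t - s))) := setLIntegral_le_lintegral _ _
    _ = ENNReal.ofReal (t ^ (-γ)) * (ENNReal.ofReal (2 ^ (1 + α)) * J + ENNReal.ofReal (2 ^ |γ|) * I) := by
        rw [lintegral_const_mul _ (by fun_prop), lintegral_add_left (by fun_prop),
          lintegral_const_mul _ mj, lintegral_const_mul _ mk]
        congr 3
        exact lintegral_sub_left_eq_self (fun y => ENNReal.ofReal (auxk e α y)) t
    _ = ENNReal.ofReal (t ^ (-γ) * (2 ^ (1 + α) * J.toReal + 2 ^ |γ| * I.toReal)) := by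
        rw [ENNReal.ofReal_mul (by positivity), ENNReal.ofReal_add (by positivity) (by positivity),
          ENNReal.ofReal_mul (by positivity), ENNReal.ofReal_mul (by positivity),
          ENNReal.ofReal_toReal hJ.ne, ENNReal.ofReal_toReal hI.ne]
    _ ≤ _ := by
        apply ENNReal.ofReal_le_ofReal
        rw [mul_comm]
        exact mul_le_mul_of_nonneg_right (by linarith) (by positivity)

lemma aux_Y {N : ℕ} (α β : ℝ)
    (G : EuclideanSpace ℝ (Fin N) → ℝ) (c₂ : ℝ) (hc₂ : 0 < c₂)
    (hGin : ∀ ξ : EuclideanSpace ℝ (Fin N), 0 < ‖ξ‖ → ‖ξ‖ ≤ 1 →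
      G ξ ≤ c₂ * ‖ξ‖ ^ (4 * β - (N : ℝ)))
    (hGout : ∀ ξ : EuclideanSpace ℝ (Fin N), 1 ≤ ‖ξ‖ →
      G ξ ≤ c₂ * ‖ξ‖ ^ (-((N : ℝ) + 2 * β)))
    (Y : EuclideanSpace ℝ (Fin N) → ℝ → ℝ)
    (hY : ∀ x t, Y x t = t ^ (α - 1 - α * (N : ℝ) / (2 * β)) * G ((t ^ (-(α / (2 * β)))) • x))
    (a : ℝ) (ha1 : N - 4 * β ≤ a) (ha2 : a ≤ N + 2 * β)
    (x : EuclideanSpace ℝ (Fin N)) (hx : x ≠ 0) (τ : ℝ) (hτ : 0 < τ) :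
    Y x τ ≤ c₂ * τ ^ (α - 1 + α / (2 * β) * (a - N)) * ‖x‖ ^ (-a) := by
  have hxn : 0 < ‖x‖ := norm_pos_iff.2 hx
  have hz : ‖(τ ^ (-(α / (2 * β)))) • x‖ = τ ^ (-(α / (2 * β))) * ‖x‖ := by
    rw [norm_smul, Real.norm_of_nonneg (by positivity)]
  have hz0 : 0 < ‖(τ ^ (-(α / (2 * β)))) • x‖ := by rw [hz]; positivity
  have hG : G ((τ ^ (-(α / (2 * β)))) • x) ≤ c₂ * ‖(τ ^ (-(α / (2 * β)))) • x‖ ^ (-a) := by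
    rcases le_total ‖(τ ^ (-(α / (2 * β)))) • x‖ 1 with h | h
    · refine (hGin _ hz0 h).trans ?_
      gcongr ?_ * ?_
      exact Real.rpow_le_rpow_of_exponent_ge hz0 h (by linarith)
    · refine (hGout _ h).trans ?_
      gcongr ?_ * ?_
      exact Real.rpow_le_rpow_of_exponent_le h (by linarith)
  rw [hY]
  calc _ ≤ τ ^ (α - 1 - α * (N : ℝ) / (2 * β)) * (c₂ * ‖(τ ^ (-(α / (2 * β)))) • x‖ ^ (-a)) := by
        gcongr
    _ = c₂ * (τ ^ (α - 1 - α * (N : ℝ) / (2 * β)) * τ ^ (-(α / (2 * β)) * (-a))) * ‖x‖ ^ (-a) := by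
        rw [hz, Real.mul_rpow (by positivity) hxn.le, ← Real.rpow_mul hτ.le]; ring
    _ = _ := by
        rw [← Real.rpow_add hτ]; congr 3; ring

lemma aux_kernel {N : ℕ} (α β : ℝ) (hα : 0 < α) (hα1 : α < 1) (hβ : 0 < β)
    (G : EuclideanSpace ℝ (Fin N) → ℝ) (c₂ : ℝ) (hc₂ : 0 < c₂)
    (hGin : ∀ ξ : EuclideanSpace ℝ (Fin N), 0 < ‖ξ‖ → ‖ξ‖ ≤ 1 →
      G ξ ≤ c₂ * ‖ξ‖ ^ (4 * β - (N : ℝ)))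
    (hGout : ∀ ξ : EuclideanSpace ℝ (Fin N), 1 ≤ ‖ξ‖ →
      G ξ ≤ c₂ * ‖ξ‖ ^ (-((N : ℝ) + 2 * β)))
    (Y : EuclideanSpace ℝ (Fin N) → ℝ → ℝ)
    (hY : ∀ x t, Y x t = t ^ (α - 1 - α * (N : ℝ) / (2 * β)) * G ((t ^ (-(α / (2 * β)))) • x))
    (ε : ℝ) (hε0 : 0 < ε) (hε : ε ≤ β)
    (x : EuclideanSpace ℝ (Fin N)) (hx : x ≠ 0) (τ : ℝ) (hτ : 0 ≤ τ) :
    Y x τ ≤ c₂ * auxk (α / (2 * β) * ε) α τ *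
      ((Metric.ball 0 1).indicator (fun x => ‖x‖ ^ (-(N - 2 * β + ε))) x +
       (Metric.ball 0 1)ᶜ.indicator (fun x => ‖x‖ ^ (-(N - 4 * β))) x) := by
  have hxn : 0 < ‖x‖ := norm_pos_iff.2 hx
  rcases hτ.eq_or_lt with rfl | hτ
  · have : α - 1 - α * (N : ℝ) / (2 * β) < 0 := by
      have : 0 ≤ α * (N : ℝ) / (2 * β) := by positivity
      linarith
    rw [hY, Real.zero_rpow this.ne, zero_mul]
    simp [auxk]
  have key := aux_Y α β G c₂ hc₂ hGin hGout Y hY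
  unfold auxk
  rw [if_pos hτ]
  by_cases hxb : ‖x‖ < 1
  · rw [indicator_of_mem (by simpa using hxb), indicator_of_notMem (by simpa using hxb), add_zero]
    split_ifs with h
    · convert key (N - 2 * β + ε) (by linarith) (by linarith) x hx τ hτ using 4
      field_simp; ring
    · refine (key (N - 4 * β) (by linarith) (by linarith) x hx τ hτ).trans ?_
      have e1 : α - 1 + α / (2 * β) * (N - 4 * β - N) = -(1 + α) := by field_simp; ring
      rw [e1]
      gcongr _ * ?_
      exact Real.rpow_le_rpow_of_exponent_ge hxn hxb.le (by linarith)
  · rw [indicator_of_notMem (by simpa using hxb), indicator_of_mem (by simpa using hxb), zero_add]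
    have hx1 := not_lt.1 hxb
    split_ifs with h
    · refine (key (N + 2 * β) (by linarith) (by linarith) x hx τ hτ).trans ?_
      gcongr c₂ * ?_ * ?_
      · refine Real.rpow_le_rpow_of_exponent_ge hτ h ?_
        have e1 : α - 1 + α / (2 * β) * (N + 2 * β - N) = 2 * α - 1 := by field_simp; ring
        have e2 : α / (2 * β) * ε ≤ α / (2 * β) * β := by gcongr
        have e3 : α / (2 * β) * β = α / 2 := by field_simp
        rw [e1]; linarith
      · exact Real.rpow_le_rpow_of_exponent_le hx1 (by linarith)
    · refine (key (N - 4 * β) (by linarith) (by linarith) x hx τ hτ).trans ?_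
      have e1 : α - 1 + α / (2 * β) * (N - 4 * β - N) = -(1 + α) := by field_simp; ring
      rw [e1]

lemma aux_exponents (N : ℕ) (β : ℝ) (hβ : 0 < β) (hN : 4 * β < (N : ℝ))
    (p : ℝ≥0∞) (hp : ENNReal.ofReal ((N : ℝ) / ((N : ℝ) - 4 * β)) < p)
    (q : ℝ) (hq : q > (N : ℝ) / (2 * β + (N : ℝ) / p.toReal)) :
    1 ≤ p ∧ 0 < q ∧ (p ≠ ⊤ → 1 ≤ p.toReal ∧ N < (N - 4 * β) * p.toReal) ∧
    ∃ m r ε : ℝ, 1 ≤ m ∧ m ≤ q ∧ 1 ≤ r ∧ 1 / r + 1 / m = 1 + 1 / p.toReal ∧ 0 < ε ∧ ε ≤ β ∧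
      (N - 2 * β + ε) * r < N := by
  have hN0 : (0:ℝ) < N := by linarith
  have hd : 0 < (N:ℝ) - 4 * β := by linarith
  have hps : 1 < (N : ℝ) / ((N : ℝ) - 4 * β) := by rw [lt_div_iff₀ hd]; linarith
  have hp1 : 1 ≤ p := by
    refine le_trans ?_ hp.le
    rw [ENNReal.one_le_ofReal]; exact hps.le
  have hfin : p ≠ ⊤ → 1 ≤ p.toReal ∧ N < (N - 4 * β) * p.toReal := by
    intro hpt
    rw [ENNReal.ofReal_lt_iff_lt_toReal (by positivity) hpt] at hp
    refine ⟨by linarith, ?_⟩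
    rw [div_lt_iff₀ hd] at hp
    linarith
  have hP0 : 0 ≤ 1 / p.toReal := by positivity
  have hPlt : N * (1 / p.toReal) < N - 4 * β := by
    by_cases hpt : p = ⊤
    · simp [hpt, hd]
    · obtain ⟨h1, h2⟩ := hfin hpt
      rw [mul_one_div, div_lt_iff₀ (by linarith)]
      exact h2
  have hqq : N < q * (2 * β + N * (1 / p.toReal)) := by
    have : (N:ℝ) / p.toReal = N * (1 / p.toReal) := by ring
    rw [this, gt_iff_lt, div_lt_iff₀ (by positivity)] at hq
    exact hq
  have hS : 0 < 2 * β + N * (1 / p.toReal) := by positivity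
  have hq0 : 0 < q := by
    by_contra h
    have : q * (2 * β + N * (1 / p.toReal)) ≤ 0 := mul_nonpos_of_nonpos_of_nonneg (not_lt.1 h) hS.le
    linarith
  have hq1 : 1 ≤ q := by
    by_contra h
    have : q * (2 * β + N * (1 / p.toReal)) ≤ 1 * (2 * β + N * (1 / p.toReal)) := by
      gcongr; linarith
    linarith
  have hqi : N * (1 / q) < 2 * β + N * (1 / p.toReal) := by
    rw [mul_one_div, div_lt_iff₀ hq0]; linarith
  refine ⟨hp1, hq0, hfin, ?_⟩
  have hm : ∃ m : ℝ, 1 ≤ m ∧ m ≤ q ∧ 1 / p.toReal ≤ 1 / m ∧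
      N * (1 / m) < 2 * β + N * (1 / p.toReal) := by
    by_cases hpt : p = ⊤
    · exact ⟨q, hq1, le_rfl, by simp [hpt, hq0.le], hqi⟩
    · obtain ⟨h1, h2⟩ := hfin hpt
      rcases le_total q p.toReal with h | h
      · exact ⟨q, hq1, le_rfl, one_div_le_one_div_of_le hq0 h, hqi⟩
      · exact ⟨p.toReal, h1, h, le_rfl, by linarith⟩
  obtain ⟨m, hm1, hmq, hmP, hmlt⟩ := hm
  set δ := 1 / m - 1 / p.toReal with hδ
  have hδ0 : 0 ≤ δ := by linarith
  have hδN : N * δ < 2 * β := by rw [hδ, mul_sub]; linarith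
  have hδ1 : δ < 1 := by
    by_contra h
    have : (N:ℝ) * 1 ≤ N * δ := by gcongr; linarith
    linarith
  have hNδ0 : 0 ≤ N * δ := by positivity
  refine ⟨m, 1 / (1 - δ), (2 * β - N * δ) / 2, hm1, hmq, ?_, ?_, by linarith, by linarith, ?_⟩
  · rw [le_div_iff₀ (by linarith)]; linarith
  · rw [one_div_one_div]; linarith
  · rw [mul_one_div, div_lt_iff₀ (by linarith)]; linarith

lemma aux_main
    (N : ℕ) (α β : ℝ)
    (hα : 0 < α ∧ α < 1) (hβ : 0 < β) (hN : 4 * β < (N : ℝ))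
    (G : EuclideanSpace ℝ (Fin N) → ℝ) (hGnonneg : ∀ ξ, 0 ≤ G ξ)
    (c₂ : ℝ) (hc₂ : 0 < c₂)
    (hGin : ∀ ξ : EuclideanSpace ℝ (Fin N), 0 < ‖ξ‖ → ‖ξ‖ ≤ 1 →
      G ξ ≤ c₂ * ‖ξ‖ ^ (4 * β - (N : ℝ)))
    (hGout : ∀ ξ : EuclideanSpace ℝ (Fin N), 1 ≤ ‖ξ‖ →
      G ξ ≤ c₂ * ‖ξ‖ ^ (-((N : ℝ) + 2 * β)))
    (Y : EuclideanSpace ℝ (Fin N) → ℝ → ℝ)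
    (hY : ∀ x t, Y x t = t ^ (α - 1 - α * (N : ℝ) / (2 * β)) * G ((t ^ (-(α / (2 * β)))) • x))
    (f : EuclideanSpace ℝ (Fin N) → ℝ → ℝ)
    (hfmeas : Measurable (Function.uncurry f))
    (γ : ℝ) (hγ : γ ≤ 1 + α) (C₀ : ℝ) (hC₀ : 0 < C₀)
    (hf1 : ∀ t : ℝ, 0 ≤ t →
      eLpNorm (fun y => f y t) 1 volume ≤ ENNReal.ofReal (C₀ * (1 + t) ^ (-γ)))
    (p : ℝ≥0∞) (hp : ENNReal.ofReal ((N : ℝ) / ((N : ℝ) - 4 * β)) < p)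
    (q : ℝ) (hq : q > (N : ℝ) / (2 * β + (N : ℝ) / p.toReal))
    (hfq : ∀ t : ℝ, 0 ≤ t →
      eLpNorm (fun y => f y t) (ENNReal.ofReal q) volume ≤ ENNReal.ofReal (C₀ * (1 + t) ^ (-γ)))
    (u : EuclideanSpace ℝ (Fin N) → ℝ → ℝ)
    (hu : ∀ x t, u x t = ∫ s in Set.Ioc (0:ℝ) t, ∫ y, Y (x - y) (t - s) * f y s) :
    ∃ C : ℝ, 0 < C ∧ ∀ t : ℝ, 2 ≤ t →
        eLpNorm (fun x => u x t) p volume ≤ ENNReal.ofReal (C * t ^ (-γ)) := by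
  obtain ⟨hp1, hq0, hfin, m, r, ε, hm1, hmq, hr1, hmr, hε0, hεβ, hεr⟩ :=
    aux_exponents N β hβ hN p hp q hq
  have hN0 : (0:ℝ) < N := by linarith
  have hNn : 0 < N := by exact_mod_cast hN0
  have hp0 : p ≠ 0 := (zero_lt_one.trans_le hp1).ne'
  have hm0 : 0 < m := by linarith
  set e := α / (2 * β) * ε with he
  have he0 : 0 < e := by have := hα.1; positivity
  -- kernels
  set k1 : EuclideanSpace ℝ (Fin N) → ℝ :=
    (Metric.ball 0 1).indicator (fun x => ‖x‖ ^ (-(N - 2 * β + ε))) with hk1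
  set k2 : EuclideanSpace ℝ (Fin N) → ℝ :=
    (Metric.ball 0 1)ᶜ.indicator (fun x => ‖x‖ ^ (-(N - 4 * β))) with hk2
  have k1m : Measurable k1 := (measurable_norm.pow_const _).indicator measurableSet_ball
  have k2m : Measurable k2 := (measurable_norm.pow_const _).indicator measurableSet_ball.compl
  have k1n : ∀ x, 0 ≤ k1 x := fun x => indicator_nonneg (fun x _ => by positivity) _
  have k2n : ∀ x, 0 ≤ k2 x := fun x => indicator_nonneg (fun x _ => by positivity) _
  set K1 : EuclideanSpace ℝ (Fin N) → ℝ≥0∞ := fun x => ENNReal.ofReal (k1 x) with hK1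
  set K2 : EuclideanSpace ℝ (Fin N) → ℝ≥0∞ := fun x => ENNReal.ofReal (k2 x) with hK2
  have K1m : Measurable K1 := k1m.ennreal_ofReal
  have K2m : Measurable K2 := k2m.ennreal_ofReal
  -- Young estimates
  obtain ⟨D1, hD1, hY1⟩ : ∃ D1 : ℝ≥0∞, D1 ≠ ⊤ ∧ ∀ g : EuclideanSpace ℝ (Fin N) → ℝ≥0∞, Measurable g →
      eLpNorm (fun x => ∫⁻ y, K1 (x - y) * g y) p volume ≤ D1 * (∫⁻ y, g y ^ m) ^ (1 / m) := by
    refine ⟨(∫⁻ y, K1 y ^ r) ^ (1 / r), ?_, fun g hg => aux_young_s18 K1 g K1m hg r m p hp0 hr1 hm1 hmr⟩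
    exact ENNReal.rpow_ne_top_of_nonneg (by positivity) (aux_K1 hNn _ r hr1 hεr).ne
  obtain ⟨D2, hD2, hY2⟩ : ∃ D2 : ℝ≥0∞, D2 ≠ ⊤ ∧ ∀ g : EuclideanSpace ℝ (Fin N) → ℝ≥0∞, Measurable g →
      eLpNorm (fun x => ∫⁻ y, K2 (x - y) * g y) p volume ≤ D2 * (∫⁻ y, g y) := by
    by_cases hpt : p = ⊤
    · refine ⟨1, by simp, fun g hg => ?_⟩
      subst hpt
      simp only [eLpNorm_exponent_top, one_mul]
      refine essSup_le_of_ae_le _ (Eventually.of_forall fun x => ?_)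
      simp only [enorm_eq_self]
      refine lintegral_mono fun y => ?_
      refine mul_le_of_le_one_left zero_le ?_
      simp only [hK2, ENNReal.ofReal_le_one]
      by_cases hx : x - y ∈ (Metric.ball (0 : EuclideanSpace ℝ (Fin N)) 1)ᶜ
      · rw [hk2, indicator_of_mem hx]
        exact Real.rpow_le_one_of_one_le_of_nonpos (by simpa using hx) (by linarith)
      · rw [hk2, indicator_of_notMem hx]; exact zero_le_one
    · obtain ⟨h1, h2⟩ := hfin hpt
      refine ⟨(∫⁻ y, K2 y ^ p.toReal) ^ (1 / p.toReal), ?_, fun g hg => ?_⟩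
      · exact ENNReal.rpow_ne_top_of_nonneg (by positivity)
          (aux_K2 _ p.toReal h1 (by linarith) h2).ne
      · have := aux_young_s18 K2 g K2m hg p.toReal 1 p hp0 h1 le_rfl (by ring)
        simpa using this
  -- normalised source
  set M : ℝ → ℝ≥0∞ := fun s => ENNReal.ofReal (C₀ * (1 + s) ^ (-γ)) with hM
  have Mm : Measurable M :=
    (((measurable_const.add measurable_id).pow_const _).const_mul _).ennreal_ofReal
  have M0 : ∀ s, 0 ≤ s → M s ≠ 0 := by
    intro s hs
    have : 0 < C₀ * (1 + s) ^ (-γ) := by positivity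
    simpa [hM] using this
  have Mt : ∀ s, M s ≠ ⊤ := fun s => ENNReal.ofReal_ne_top
  set h : EuclideanSpace ℝ (Fin N) → ℝ → ℝ≥0∞ := fun y s => ‖f y s‖ₑ * (M s)⁻¹ with hh
  have hhm : Measurable (Function.uncurry h) :=
    hfmeas.enorm.mul (Mm.comp measurable_snd).inv
  have hfs : ∀ s, Measurable fun y => f y s := fun s => hfmeas.comp measurable_prodMk_right
  have h1 : ∀ s, 0 ≤ s → ∫⁻ y, h y s ≤ 1 := by
    intro s hs
    have := hf1 s hs
    rw [eLpNorm_one_eq_lintegral_enorm] at this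
    simp only [hh]
    rw [lintegral_mul_const _ (hfs s).enorm]
    calc _ ≤ M s * (M s)⁻¹ := by gcongr
      _ = 1 := ENNReal.mul_inv_cancel (M0 s hs) (Mt s)
  have h2 : ∀ s, 0 ≤ s → ∫⁻ y, h y s ^ q ≤ 1 := by
    intro s hs
    have := hfq s hs
    rw [eLpNorm_eq_lintegral_rpow_enorm_toReal (by simpa using hq0) ENNReal.ofReal_ne_top,
      ENNReal.toReal_ofReal hq0.le] at this
    have := ENNReal.rpow_le_rpow this hq0.le
    rw [← ENNReal.rpow_mul, one_div_mul_cancel hq0.ne', ENNReal.rpow_one] at this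
    simp only [hh, ENNReal.mul_rpow_of_nonneg _ _ hq0.le]
    rw [lintegral_mul_const _ ((hfs s).enorm.pow_const q)]
    calc _ ≤ M s ^ q * ((M s)⁻¹) ^ q := by gcongr
      _ = 1 := by
        rw [← ENNReal.mul_rpow_of_nonneg _ _ hq0.le, ENNReal.mul_inv_cancel (M0 s hs) (Mt s),
          ENNReal.one_rpow]
  have h3 : ∀ s, 0 ≤ s → ∫⁻ y, h y s ^ m ≤ 2 := by
    intro s hs
    have hhs : Measurable fun y => h y s := hhm.comp measurable_prodMk_right
    calc ∫⁻ y, h y s ^ m ≤ ∫⁻ y, (h y s + h y s ^ q) := by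
          refine lintegral_mono fun y => ?_
          rcases le_total (h y s) 1 with hle | hle
          · refine le_trans ?_ le_self_add
            calc h y s ^ m ≤ h y s ^ (1:ℝ) := ENNReal.rpow_le_rpow_of_exponent_ge hle hm1
              _ = _ := ENNReal.rpow_one _
          · refine le_trans ?_ le_add_self
            exact ENNReal.rpow_le_rpow_of_exponent_le hle hmq
      _ = (∫⁻ y, h y s) + ∫⁻ y, h y s ^ q := lintegral_add_left hhs _
      _ ≤ 1 + 1 := add_le_add (h1 s hs) (h2 s hs)
      _ = 2 := one_add_one_eq_two
  obtain ⟨CW, hCW, hW⟩ := aux_W e α γ he0 hα.1 hγ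
  set D := D1 * 2 ^ (1 / m) + D2 with hD
  have hDt : D ≠ ⊤ := by
    refine ENNReal.add_ne_top.2 ⟨ENNReal.mul_ne_top hD1 ?_, hD2⟩
    exact ENNReal.rpow_ne_top_of_nonneg (by positivity) (by simp)
  refine ⟨D.toReal * (c₂ * C₀ * CW) + 1, by positivity, fun t ht => ?_⟩
  have ht0 : 0 < t := by linarith
  -- weight
  set w : ℝ → ℝ≥0∞ := fun s => ENNReal.ofReal (c₂ * auxk e α (t - s)) * M s with hw
  have am : Measurable fun s => auxk e α (t - s) :=
    (auxk_meas e α).comp (measurable_const.sub measurable_id)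
  have cm : Measurable fun s => ENNReal.ofReal (c₂ * auxk e α (t - s)) :=
    (am.const_mul _).ennreal_ofReal
  have wm : Measurable w := cm.mul Mm
  set ν : Measure ℝ := (volume.restrict (Ioc (0:ℝ) t)).withDensity w with hν
  have hνu : ν univ ≤ ENNReal.ofReal (c₂ * C₀ * CW * t ^ (-γ)) := by
    rw [hν, withDensity_apply _ MeasurableSet.univ, Measure.restrict_univ]
    calc ∫⁻ s in Ioc (0:ℝ) t, w s = ∫⁻ s in Ioc (0:ℝ) t, ENNReal.ofReal (c₂ * C₀) *
          (ENNReal.ofReal (auxk e α (t - s)) * ENNReal.ofReal ((1 + s) ^ (-γ))) := by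
          refine lintegral_congr fun s => ?_
          simp only [hw, hM]
          rw [ENNReal.ofReal_mul hc₂.le, ENNReal.ofReal_mul hC₀.le, ENNReal.ofReal_mul hc₂.le]
          ring
      _ = ENNReal.ofReal (c₂ * C₀) * ∫⁻ s in Ioc (0:ℝ) t,
          (ENNReal.ofReal (auxk e α (t - s)) * ENNReal.ofReal ((1 + s) ^ (-γ))) :=
          lintegral_const_mul _ (am.ennreal_ofReal.mul
            ((measurable_const.add measurable_id).pow_const _).ennreal_ofReal)
      _ ≤ ENNReal.ofReal (c₂ * C₀) * ENNReal.ofReal (CW * t ^ (-γ)) := by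
          gcongr; exact hW t ht
      _ = _ := by rw [← ENNReal.ofReal_mul (by positivity)]; congr 1; ring
  have hνae : ∀ᵐ s ∂ν, 0 ≤ s := by
    apply (withDensity_absolutelyContinuous _ w).ae_le
    filter_upwards [ae_restrict_mem measurableSet_Ioc] with s hs using hs.1.le
  set g : EuclideanSpace ℝ (Fin N) → ℝ≥0∞ := fun y => ∫⁻ s, h y s ∂ν with hg
  have gm : Measurable g := hhm.lintegral_prod_right
  have hgm : ∫⁻ y, g y ^ m ≤ ν univ ^ m * 2 :=
    aux_jensen ν h hhm m hm1 2 (hνae.mono h3)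
  have hg1 : ∫⁻ y, g y ≤ ν univ := by
    have := aux_jensen ν h hhm 1 le_rfl 1 (hνae.mono (by simpa using h1))
    simpa using this
  have gform : ∀ y, g y = ∫⁻ s in Ioc (0:ℝ) t, ENNReal.ofReal (c₂ * auxk e α (t - s)) * ‖f y s‖ₑ := by
    intro y
    simp only [hg, hν]
    have hhy : Measurable (h y) := hhm.comp measurable_prodMk_left
    rw [lintegral_withDensity_eq_lintegral_mul _ wm hhy]
    refine setLIntegral_congr_fun measurableSet_Ioc fun s hs => ?_
    simp only [Pi.mul_apply, hw, hh, Function.comp, Function.uncurry]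
    calc _ = ENNReal.ofReal (c₂ * auxk e α (t - s)) * ‖f y s‖ₑ * (M s * (M s)⁻¹) := by ring
      _ = _ := by rw [ENNReal.mul_inv_cancel (M0 s hs.1.le) (Mt s), mul_one]
  -- pointwise bound
  have hpt : ∀ x, ‖u x t‖ₑ ≤ ‖(∫⁻ y, K1 (x - y) * g y) + ∫⁻ y, K2 (x - y) * g y‖ₑ := by
    intro x
    rw [enorm_eq_self, hu]
    have Kx1 : Measurable fun y => K1 (x - y) := K1m.comp (measurable_const.sub measurable_id)
    have Kx2 : Measurable fun y => K2 (x - y) := K2m.comp (measurable_const.sub measurable_id)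
    calc ‖∫ s in Ioc (0:ℝ) t, ∫ y, Y (x - y) (t - s) * f y s‖ₑ
        ≤ ∫⁻ s in Ioc (0:ℝ) t, ‖∫ y, Y (x - y) (t - s) * f y s‖ₑ := enorm_integral_le_lintegral_enorm _
      _ ≤ ∫⁻ s in Ioc (0:ℝ) t, ∫⁻ y, ‖Y (x - y) (t - s) * f y s‖ₑ :=
          lintegral_mono fun s => enorm_integral_le_lintegral_enorm _
      _ ≤ ∫⁻ s in Ioc (0:ℝ) t, ∫⁻ y, (K1 (x - y) + K2 (x - y)) *
          (ENNReal.ofReal (c₂ * auxk e α (t - s)) * ‖f y s‖ₑ) := by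
          refine setLIntegral_mono' measurableSet_Ioc fun s hs => ?_
          refine lintegral_mono_ae ?_
          have hne : ∀ᵐ y : EuclideanSpace ℝ (Fin N), y ≠ x := by
            have : Nonempty (Fin N) := ⟨⟨0, hNn⟩⟩
            exact Measure.ae_ne volume x
          filter_upwards [hne] with y hy
          rw [enorm_mul, ← mul_assoc]
          gcongr
          have hts : 0 ≤ t - s := by linarith [hs.2]
          have hYn : 0 ≤ Y (x - y) (t - s) := by
            rw [hY]; exact mul_nonneg (by positivity) (hGnonneg _)
          have kb := aux_kernel α β hα.1 hα.2 hβ G c₂ hc₂ hGin hGout Y hY ε hε0 hεβ (x - y)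
            (sub_ne_zero.2 hy.symm) (t - s) hts
          rw [Real.enorm_of_nonneg hYn]
          simp only [hK1, hK2]
          rw [← ENNReal.ofReal_add (k1n _) (k2n _),
            ← ENNReal.ofReal_mul (add_nonneg (k1n _) (k2n _))]
          apply ENNReal.ofReal_le_ofReal
          rw [mul_comm]
          exact kb
      _ = ∫⁻ y, ∫⁻ s in Ioc (0:ℝ) t, (K1 (x - y) + K2 (x - y)) *
          (ENNReal.ofReal (c₂ * auxk e α (t - s)) * ‖f y s‖ₑ) := by
          apply lintegral_lintegral_swap
          apply Measurable.aemeasurable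
          refine Measurable.mul ((Kx1.add Kx2).comp measurable_snd) ?_
          exact Measurable.mul (cm.comp measurable_fst) (hfmeas.comp measurable_swap).enorm
      _ = ∫⁻ y, (K1 (x - y) * g y + K2 (x - y) * g y) := by
          refine lintegral_congr fun y => ?_
          have hfy : Measurable fun s => f y s := hfmeas.comp measurable_prodMk_left
          have hcf : Measurable fun s => ENNReal.ofReal (c₂ * auxk e α (t - s)) * ‖f y s‖ₑ :=
            cm.mul hfy.enorm
          rw [lintegral_const_mul _ hcf, ← gform, add_mul]
      _ = _ := lintegral_add_left (Kx1.mul gm) _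
  have meas1 : Measurable fun x => ∫⁻ y, K1 (x - y) * g y := by
    apply Measurable.lintegral_prod_right
    fun_prop
  have meas2 : Measurable fun x => ∫⁻ y, K2 (x - y) * g y := by
    apply Measurable.lintegral_prod_right
    fun_prop
  calc eLpNorm (fun x => u x t) p volume
      ≤ eLpNorm ((fun x => ∫⁻ y, K1 (x - y) * g y) + fun x => ∫⁻ y, K2 (x - y) * g y) p volume :=
        eLpNorm_mono_enorm hpt
    _ ≤ _ := eLpNorm_add_le meas1.aestronglyMeasurable meas2.aestronglyMeasurable hp1
    _ ≤ D1 * (ν univ ^ m * 2) ^ (1 / m) + D2 * ν univ := by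
        refine add_le_add ((hY1 g gm).trans ?_) ((hY2 g gm).trans ?_)
        · gcongr
        · gcongr
    _ = D * ν univ := by
        rw [ENNReal.mul_rpow_of_nonneg _ _ (by positivity), ← ENNReal.rpow_mul,
          mul_one_div_cancel hm0.ne', ENNReal.rpow_one, hD]
        ring
    _ ≤ D * ENNReal.ofReal (c₂ * C₀ * CW * t ^ (-γ)) := by gcongr
    _ = ENNReal.ofReal (D.toReal * (c₂ * C₀ * CW) * t ^ (-γ)) := by
        conv_lhs => rw [← ENNReal.ofReal_toReal hDt]
        rw [← ENNReal.ofReal_mul (by positivity)]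
        congr 1; ring
    _ ≤ _ := by
        apply ENNReal.ofReal_le_ofReal
        exact mul_le_mul_of_nonneg_right (by linarith) (by positivity)

theorem global_decay_above_pstar
    (N : ℕ) (α β : ℝ)
    (hα : 0 < α ∧ α < 1) (hβ : 0 < β ∧ β ≤ 1) (hN : 4 * β < (N : ℝ))
    (G : EuclideanSpace ℝ (Fin N) → ℝ)
    (hGmeas : Measurable G) (hGnonneg : ∀ ξ, 0 ≤ G ξ)
    (c₁ c₂ : ℝ) (hc₁ : 0 < c₁) (hc₂ : 0 < c₂)
    (hGin : ∀ ξ : EuclideanSpace ℝ (Fin N), 0 < ‖ξ‖ → ‖ξ‖ ≤ 1 →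
      c₁ * ‖ξ‖ ^ (4 * β - (N : ℝ)) ≤ G ξ ∧ G ξ ≤ c₂ * ‖ξ‖ ^ (4 * β - (N : ℝ)))
    (hGout : ∀ ξ : EuclideanSpace ℝ (Fin N), 1 ≤ ‖ξ‖ →
      c₁ * ‖ξ‖ ^ (-((N : ℝ) + 2 * β)) ≤ G ξ ∧ G ξ ≤ c₂ * ‖ξ‖ ^ (-((N : ℝ) + 2 * β)))
    (Y : EuclideanSpace ℝ (Fin N) → ℝ → ℝ)
    (hY : ∀ x t, Y x t = t ^ (α - 1 - α * (N : ℝ) / (2 * β)) * G ((t ^ (-(α / (2 * β)))) • x))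
    (f : EuclideanSpace ℝ (Fin N) → ℝ → ℝ)
    (hfmeas : Measurable (Function.uncurry f))
    (γ : ℝ) (C₀ : ℝ) (hC₀ : 0 < C₀)
    (hf1 : ∀ t : ℝ, 0 ≤ t →
      eLpNorm (fun y => f y t) 1 volume ≤ ENNReal.ofReal (C₀ * (1 + t) ^ (-γ)))
    (R₀ C₁ : ℝ) (hR₀ : 0 < R₀) (hC₁ : 0 < C₁)
    (hfdec : ∀ (x : EuclideanSpace ℝ (Fin N)) (t : ℝ), R₀ ≤ ‖x‖ → 0 ≤ t →
      |f x t| ≤ C₁ * ‖x‖ ^ (-(N : ℝ)) * (1 + t) ^ (-γ))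
    (p : ℝ≥0∞) (hp : ENNReal.ofReal ((N : ℝ) / ((N : ℝ) - 4 * β)) < p)
    (q : ℝ) (hq : q > (N : ℝ) / (2 * β + (N : ℝ) / p.toReal))
    (hfq : ∀ t : ℝ, 0 ≤ t →
      eLpNorm (fun y => f y t) (ENNReal.ofReal q) volume ≤ ENNReal.ofReal (C₀ * (1 + t) ^ (-γ)))
    (u : EuclideanSpace ℝ (Fin N) → ℝ → ℝ)
    (hu : ∀ x t, u x t = ∫ s in Set.Ioc (0:ℝ) t, ∫ y, Y (x - y) (t - s) * f y s) :
    ∃ C : ℝ, 0 < C ∧ ∀ t : ℝ, 2 ≤ t →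
      (γ ≤ 1 + α →
        eLpNorm (fun x => u x t) p volume ≤ ENNReal.ofReal (C * t ^ (-γ))) ∧
      (1 + α ≤ γ →
        eLpNorm (fun x => u x t) p volume ≤ ENNReal.ofReal (C * t ^ (-(1 + α)))) := by
  have hGin' := fun ξ h1 h2 => (hGin ξ h1 h2).2
  have hGout' := fun ξ h1 => (hGout ξ h1).2
  rcases le_total γ (1 + α) with hγ | hγ
  · obtain ⟨C, hC, hb⟩ := aux_main N α β hα hβ.1 hN G hGnonneg c₂ hc₂ hGin' hGout' Y hY f hfmeas γ hγ
      C₀ hC₀ hf1 p hp q hq hfq u hu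
    refine ⟨C, hC, fun t ht => ⟨fun _ => hb t ht, fun h => ?_⟩⟩
    have : γ = 1 + α := le_antisymm hγ h
    rw [← this]
    exact hb t ht
  · have hmono : ∀ t : ℝ, 0 ≤ t → ENNReal.ofReal (C₀ * (1 + t) ^ (-γ)) ≤
        ENNReal.ofReal (C₀ * (1 + t) ^ (-(1 + α))) := by
      intro t ht
      apply ENNReal.ofReal_le_ofReal
      exact mul_le_mul_of_nonneg_left
        (Real.rpow_le_rpow_of_exponent_le (by linarith) (by linarith)) hC₀.le
    obtain ⟨C, hC, hb⟩ := aux_main N α β hα hβ.1 hN G hGnonneg c₂ hc₂ hGin' hGout' Y hY f hfmeas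
      (1 + α) le_rfl C₀ hC₀ (fun t ht => (hf1 t ht).trans (hmono t ht)) p hp q hq
      (fun t ht => (hfq t ht).trans (hmono t ht)) u hu
    refine ⟨C, hC, fun t ht => ⟨fun h => ?_, fun _ => hb t ht⟩⟩
    have : γ = 1 + α := le_antisymm h hγ
    rw [this]
    exact hb t ht
end

section
/- Let γ ∈ ℝ, ν > 0 and suppose ‖f(·,t)‖_{L^1(ℝ^N)} ≤ C₀ (1+t)^{−γ} for all t ≥ 0. Define I(x,t) := ∫₀ᵗ ∫_{|y| < |x|/2} Y(x−y, t−s) |f(y,s)| dy ds. Then for every p ∈ [1,∞] there is a constant C such that, for all t ≥ 2, ‖I(·,t)‖_{L^p({|x| ≥ ν t^{α/(2β)}})} ≤ C ( t^{α−1−(αN/(2β))(1−1/p)} ∫₀^{t/2} (1+s)^{−γ} ds + t^{α−γ−(αN/(2β))(1−1/p)} ). -/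
open MeasureTheory Real Set Filter
open scoped ENNReal Pointwise

lemma aux_rpow_comp {a b : ℝ} (e : ℝ) (ha : 0 < a) (h1 : a / 2 ≤ b) (h2 : b ≤ 2 * a) :
    b ^ e ≤ 2 ^ |e| * a ^ e := by
  have hb : 0 < b := by linarith
  rcases le_total 0 e with he | he
  · rw [abs_of_nonneg he, ← Real.mul_rpow (by norm_num) ha.le]
    exact Real.rpow_le_rpow hb.le h2 he
  · rw [abs_of_nonpos he]
    have := Real.rpow_le_rpow_of_nonpos (by positivity) h1 he
    refine this.trans (le_of_eq ?_)
    rw [Real.div_rpow ha.le (by norm_num), Real.rpow_neg (by norm_num)]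
    field_simp

lemma aux_memLp (N : ℕ) (r : ℝ) (hr : (N : ℝ) < r) (p : ℝ≥0∞) (hp : 1 ≤ p) :
    MemLp (fun x : EuclideanSpace ℝ (Fin N) => (1 + ‖x‖) ^ (-r)) p volume := by
  have hm : AEStronglyMeasurable (fun x : EuclideanSpace ℝ (Fin N) => (1 + ‖x‖) ^ (-r)) volume :=
    Measurable.aestronglyMeasurable (by fun_prop)
  have hr0 : 0 < r := lt_of_le_of_lt (Nat.cast_nonneg N) hr
  by_cases htop : p = ∞
  · subst htop
    refine memLp_top_of_bound hm 1 (Eventually.of_forall fun x => ?_)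
    rw [Real.norm_of_nonneg (by positivity)]
    exact Real.rpow_le_one_of_one_le_of_nonpos (by linarith [norm_nonneg x]) (by linarith)
  · rw [← integrable_norm_rpow_iff hm (by positivity) htop]
    have h1 : 1 ≤ p.toReal := by
      have := ENNReal.toReal_mono htop hp
      simpa using this
    have : Integrable (fun x : EuclideanSpace ℝ (Fin N) => (1 + ‖x‖) ^ (-(r * p.toReal))) volume := by
      apply integrable_one_add_norm
      rw [finrank_euclideanSpace_fin]
      nlinarith
    refine this.congr (Eventually.of_forall fun x => ?_)
    simp only
    rw [Real.norm_of_nonneg (by positivity), ← Real.rpow_mul (by positivity)]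
    congr 1; ring

lemma aux_norm (N : ℕ) (r : ℝ) (hr : (N : ℝ) < r) (p : ℝ≥0∞) (hp : 1 ≤ p) :
    ∃ A : ℝ, 0 < A ∧ ∀ R : ℝ, 0 < R →
      eLpNorm (fun x : EuclideanSpace ℝ (Fin N) => ‖x‖ ^ (-r)) p
        (volume.restrict {x : EuclideanSpace ℝ (Fin N) | R ≤ ‖x‖}) ≤
      ENNReal.ofReal (A * R ^ (-r + N / p.toReal)) := by
  have hg := aux_memLp N r hr p hp
  set g := fun x : EuclideanSpace ℝ (Fin N) => (1 + ‖x‖) ^ (-r) with hgdef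
  have hr0 : 0 < r := lt_of_le_of_lt (Nat.cast_nonneg N) hr
  refine ⟨2 ^ r * ((eLpNorm g p volume).toReal + 1), by positivity, fun R hR => ?_⟩
  have hmeas : MeasurableSet {x : EuclideanSpace ℝ (Fin N) | R ≤ ‖x‖} :=
    measurableSet_le measurable_const measurable_norm
  have step1 : eLpNorm (fun x : EuclideanSpace ℝ (Fin N) => ‖x‖ ^ (-r)) p
        (volume.restrict {x : EuclideanSpace ℝ (Fin N) | R ≤ ‖x‖}) ≤
      eLpNorm (fun x => (2 ^ r * R ^ (-r)) * g (R⁻¹ • x)) p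
        (volume.restrict {x : EuclideanSpace ℝ (Fin N) | R ≤ ‖x‖}) := by
    refine eLpNorm_mono_ae_real ((ae_restrict_iff' hmeas).2 (Eventually.of_forall fun x hx => ?_))
    have hx' : R ≤ ‖x‖ := hx
    have hx0 : 0 < ‖x‖ := hR.trans_le hx'
    rw [Real.norm_of_nonneg (by positivity)]
    simp only [hgdef, norm_smul, norm_inv, Real.norm_of_nonneg hR.le]
    have h2 : 1 + R⁻¹ * ‖x‖ ≤ 2 * (R⁻¹ * ‖x‖) := by
      have : 1 ≤ R⁻¹ * ‖x‖ := by
        rw [inv_mul_eq_div, le_div_iff₀ hR]; linarith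
      linarith
    have h3 := Real.rpow_le_rpow_of_nonpos (z := -r) (by positivity) h2 (by linarith)
    calc ‖x‖ ^ (-r) = 2 ^ r * R ^ (-r) * (2 * (R⁻¹ * ‖x‖)) ^ (-r) := by
          rw [Real.mul_rpow (by norm_num) (by positivity), Real.mul_rpow (by positivity) hx0.le,
            Real.inv_rpow hR.le, Real.rpow_neg (by norm_num : (0:ℝ) ≤ 2)]
          have : R ^ (-r) ≠ 0 := by positivity
          have h4 : (2:ℝ) ^ r ≠ 0 := by positivity
          field_simp
      _ ≤ _ := by gcongr
  have step2 : eLpNorm (fun x => g (R⁻¹ • x)) p volume =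
      ENNReal.ofReal (R ^ (N / p.toReal)) * eLpNorm g p volume := by
    have hmap := Measure.map_addHaar_smul (volume : Measure (EuclideanSpace ℝ (Fin N)))
      (r := R⁻¹) (by positivity)
    have h5 : eLpNorm g p (Measure.map (R⁻¹ • ·) volume) = eLpNorm (fun x => g (R⁻¹ • x)) p volume :=
      eLpNorm_map_measure (Measurable.aestronglyMeasurable (by fun_prop)) (by fun_prop)
    rw [← h5, hmap, finrank_euclideanSpace_fin, eLpNorm_smul_measure_of_ne_zero (by positivity)]
    rw [smul_eq_mul]
    congr 1
    rw [ENNReal.ofReal_rpow_of_pos (by positivity)]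
    congr 1
    rw [abs_of_pos (by positivity), inv_pow, inv_inv, ← Real.rpow_natCast, ← Real.rpow_mul hR.le]
    congr 1
    simp [div_eq_mul_inv]
  refine step1.trans ((eLpNorm_mono_measure _ Measure.restrict_le_self).trans ?_)
  rw [show (fun x => (2 ^ r * R ^ (-r)) * g (R⁻¹ • x)) =
    (2 ^ r * R ^ (-r)) • (fun x => g (R⁻¹ • x)) from rfl, eLpNorm_const_smul, step2,
    Real.enorm_of_nonneg (by positivity), ← ENNReal.ofReal_toReal hg.2.ne,
    ← ENNReal.ofReal_mul (by positivity), ← ENNReal.ofReal_mul (by positivity)]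
  apply ENNReal.ofReal_le_ofReal
  rw [ENNReal.toReal_ofReal (by positivity), Real.rpow_add hR]
  have : 0 ≤ (eLpNorm g p volume).toReal := by positivity
  have : 0 ≤ 2 ^ r * (R ^ (-r) * R ^ (N / p.toReal)) := by positivity
  nlinarith

/-- The time integral. -/
lemma aux_time_s19 (α γ t : ℝ) (hα : 0 < α) (ht : 2 ≤ t) :
    ∃ Φ : ℝ → ℝ, IntegrableOn Φ (Ioc 0 t) ∧
      (∀ s ∈ Ioc (0:ℝ) t, (t - s) ^ (2 * α - 1) * (1 + s) ^ (-γ) ≤ Φ s) ∧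
      (∫ s in Ioc (0:ℝ) t, Φ s) = 2 ^ |2 * α - 1| * t ^ (2 * α - 1) *
          (∫ s in Ioc (0:ℝ) (t / 2), (1 + s) ^ (-γ)) +
        2 ^ |-γ| * t ^ (-γ) * ((t / 2) ^ (2 * α) / (2 * α)) := by
  set a : ℝ := 2 ^ |2 * α - 1| * t ^ (2 * α - 1)
  set b : ℝ := 2 ^ |-γ| * t ^ (-γ)
  have ht0 : 0 < t := by linarith
  have i1 : IntegrableOn (fun s : ℝ => a * (1 + s) ^ (-γ)) (Ioc 0 (t/2)) := by
    apply Integrable.const_mul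
    apply IntegrableOn.mono_set _ Ioc_subset_Icc_self
    apply ContinuousOn.integrableOn_Icc
    apply ContinuousOn.rpow_const (by fun_prop)
    intro s hs; left; linarith [hs.1]
  have ii : IntervalIntegrable (fun s : ℝ => (t - s) ^ (2 * α - 1)) volume (t/2) t := by
    have := (intervalIntegral.intervalIntegrable_rpow' (a := t/2) (b := 0)
      (r := 2 * α - 1) (by linarith)).comp_sub_left t
    convert this using 1 <;> ring
  have i2 : IntegrableOn (fun s : ℝ => b * (t - s) ^ (2 * α - 1)) (Ioc (t/2) t) := by
    apply Integrable.const_mul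
    exact (intervalIntegrable_iff_integrableOn_Ioc_of_le (by linarith)).1 ii
  have s1 : Ioc 0 (t/2) ⊆ Ioc 0 t := Ioc_subset_Ioc_right (by linarith)
  have s2 : Ioc (t/2) t ⊆ Ioc 0 t := Ioc_subset_Ioc_left (by linarith)
  have j1 := i1.integrable_indicator measurableSet_Ioc
  have j2 := i2.integrable_indicator measurableSet_Ioc
  refine ⟨fun s => (Ioc 0 (t/2)).indicator (fun s : ℝ => a * (1 + s) ^ (-γ)) s +
    (Ioc (t/2) t).indicator (fun s : ℝ => b * (t - s) ^ (2 * α - 1)) s,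
    (j1.add j2).integrableOn, ?_, ?_⟩
  · intro s hs
    have hs1 : 0 < 1 + s := by linarith [hs.1]
    have hs2 : 0 ≤ t - s := by linarith [hs.2]
    by_cases h : s ≤ t / 2
    · have m1 : s ∈ Ioc 0 (t/2) := ⟨hs.1, h⟩
      have m2 : s ∉ Ioc (t/2) t := fun h' => absurd h'.1 (not_lt.2 h)
      simp only [indicator_of_mem m1, indicator_of_notMem m2, add_zero]
      gcongr
      exact aux_rpow_comp _ ht0 (by linarith) (by linarith [hs.1])
    · push Not at h
      have m1 : s ∉ Ioc 0 (t/2) := fun h' => absurd h'.2 (not_le.2 h)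
      have m2 : s ∈ Ioc (t/2) t := ⟨h, hs.2⟩
      simp only [indicator_of_notMem m1, indicator_of_mem m2, zero_add]
      rw [mul_comm]
      gcongr
      exact aux_rpow_comp _ ht0 (by linarith) (by linarith [hs.2])
  · rw [integral_add j1.integrableOn j2.integrableOn, setIntegral_indicator measurableSet_Ioc,
      setIntegral_indicator measurableSet_Ioc, inter_eq_right.2 s1, inter_eq_right.2 s2,
      integral_const_mul, integral_const_mul]
    congr 2
    rw [← intervalIntegral.integral_of_le (by linarith),
      intervalIntegral.integral_comp_sub_left (fun u => u ^ (2 * α - 1)) t,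
      integral_rpow (Or.inl (by linarith))]
    rw [sub_self, Real.zero_rpow (by linarith)]
    ring_nf

theorem exterior_inner_term_bound
    (N : ℕ) (α β : ℝ)
    (hα : 0 < α ∧ α < 1) (hβ : 0 < β ∧ β ≤ 1) (hN : 4 * β < (N : ℝ))
    (G : EuclideanSpace ℝ (Fin N) → ℝ)
    (hGmeas : Measurable G) (hGnonneg : ∀ ξ, 0 ≤ G ξ)
    (c₁ c₂ : ℝ) (hc₁ : 0 < c₁) (hc₂ : 0 < c₂)
    (hGin : ∀ ξ : EuclideanSpace ℝ (Fin N), 0 < ‖ξ‖ → ‖ξ‖ ≤ 1 →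
      c₁ * ‖ξ‖ ^ (4 * β - (N : ℝ)) ≤ G ξ ∧ G ξ ≤ c₂ * ‖ξ‖ ^ (4 * β - (N : ℝ)))
    (hGout : ∀ ξ : EuclideanSpace ℝ (Fin N), 1 ≤ ‖ξ‖ →
      c₁ * ‖ξ‖ ^ (-((N : ℝ) + 2 * β)) ≤ G ξ ∧ G ξ ≤ c₂ * ‖ξ‖ ^ (-((N : ℝ) + 2 * β)))
    (Y : EuclideanSpace ℝ (Fin N) → ℝ → ℝ)
    (hY : ∀ x t, Y x t = t ^ (α - 1 - α * (N : ℝ) / (2 * β)) * G ((t ^ (-(α / (2 * β)))) • x))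
    (f : EuclideanSpace ℝ (Fin N) → ℝ → ℝ)
    (hfmeas : Measurable (Function.uncurry f))
    (γ : ℝ) (C₀ : ℝ) (hC₀ : 0 < C₀)
    (hf1 : ∀ t : ℝ, 0 ≤ t →
      eLpNorm (fun y => f y t) 1 volume ≤ ENNReal.ofReal (C₀ * (1 + t) ^ (-γ)))
    (ν : ℝ) (hν : 0 < ν)
    (p : ℝ≥0∞) (hp : 1 ≤ p) :
    ∃ C : ℝ, 0 < C ∧ ∀ t : ℝ, 2 ≤ t →
      eLpNorm
          (fun x : EuclideanSpace ℝ (Fin N) =>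
            ∫ s in Set.Ioc (0:ℝ) t,
              ∫ y in {y : EuclideanSpace ℝ (Fin N) | ‖y‖ < ‖x‖ / 2},
                Y (x - y) (t - s) * |f y s|) p
          (volume.restrict {x : EuclideanSpace ℝ (Fin N) | ν * t ^ (α / (2 * β)) ≤ ‖x‖}) ≤
        ENNReal.ofReal
          (C * (t ^ (α - 1 - (α * (N : ℝ) / (2 * β)) * (1 - 1 / p.toReal)) *
                  (∫ s in Set.Ioc (0:ℝ) (t / 2), (1 + s) ^ (-γ)) +
                t ^ (α - γ - (α * (N : ℝ) / (2 * β)) * (1 - 1 / p.toReal)))) := by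
  obtain ⟨hα0, hα1⟩ := hα
  obtain ⟨hβ0, hβ1⟩ := hβ
  set r : ℝ := (N : ℝ) + 2 * β with hr
  set θ : ℝ := α / (2 * β) with hθ
  have hN0 : (0:ℝ) ≤ N := Nat.cast_nonneg N
  have hr0 : 0 < r := by positivity
  have hθβ : θ * (2 * β) = α := by rw [hθ]; field_simp
  have hθN : α * (N : ℝ) / (2 * β) = θ * N := by rw [hθ]; ring
  -- global bound on `G`
  have hG : ∀ ξ : EuclideanSpace ℝ (Fin N), 0 < ‖ξ‖ → G ξ ≤ c₂ * ‖ξ‖ ^ (-r) := by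
    intro ξ hξ
    rcases le_total ‖ξ‖ 1 with h | h
    · refine (hGin ξ hξ h).2.trans ?_
      gcongr ?_ * ?_
      exact Real.rpow_le_rpow_of_exponent_ge hξ h (by rw [hr]; linarith)
    · exact (hGout ξ h).2
  -- pointwise bound on `Y`
  have hYb : ∀ (x y : EuclideanSpace ℝ (Fin N)) (τ : ℝ), 0 < ‖x‖ → ‖y‖ < ‖x‖ / 2 → 0 ≤ τ →
      ‖Y (x - y) τ‖ ≤ c₂ * 2 ^ r * ‖x‖ ^ (-r) * τ ^ (2 * α - 1) := by
    intro x y τ hx hy hτ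
    rw [hY, hθN]
    rcases hτ.eq_or_lt with h0 | hτ0
    · rw [← h0, Real.zero_rpow, zero_mul, norm_zero]
      · positivity
      · have h1 : θ * (4 * β) < θ * N := by
          have : 0 < θ := by positivity
          gcongr
        nlinarith
    · have hxy : ‖x‖ / 2 ≤ ‖x - y‖ := by
        have := norm_sub_norm_le x y
        linarith
      have hxy0 : 0 < ‖x - y‖ := by linarith
      have hτp : 0 < τ ^ (-θ) := by positivity
      have hn : ‖(τ ^ (-θ)) • (x - y)‖ = τ ^ (-θ) * ‖x - y‖ := by
        rw [norm_smul, Real.norm_of_nonneg hτp.le]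
      rw [Real.norm_of_nonneg (mul_nonneg (by positivity) (hGnonneg _))]
      have h1 := hG ((τ ^ (-θ)) • (x - y)) (by rw [hn]; positivity)
      rw [hn, Real.mul_rpow hτp.le hxy0.le, ← Real.rpow_mul hτ] at h1
      have h2 : ‖x - y‖ ^ (-r) ≤ 2 ^ r * ‖x‖ ^ (-r) := by
        refine (Real.rpow_le_rpow_of_nonpos (by positivity) hxy (by linarith)).trans (le_of_eq ?_)
        rw [Real.div_rpow hx.le (by norm_num), Real.rpow_neg (by norm_num : (0:ℝ) ≤ 2)]
        field_simp
      calc τ ^ (α - 1 - θ * N) * G ((τ ^ (-θ)) • (x - y))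
          ≤ τ ^ (α - 1 - θ * N) * (c₂ * (τ ^ (-θ * -r) * (2 ^ r * ‖x‖ ^ (-r)))) := by
            refine mul_le_mul_of_nonneg_left (h1.trans ?_) (by positivity)
            gcongr
        _ = c₂ * 2 ^ r * ‖x‖ ^ (-r) * (τ ^ (α - 1 - θ * N) * τ ^ (-θ * -r)) := by ring
        _ = _ := by
            rw [← Real.rpow_add hτ0]
            congr 2
            rw [hr]
            linear_combination hθβ
  obtain ⟨A, hA, hAb⟩ := aux_norm N r (by rw [hr]; linarith) p hp
  set e : ℝ := -r + N / p.toReal with he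
  refine ⟨c₂ * 2 ^ r * C₀ * A * ν ^ e * (2 ^ |2 * α - 1| + 2 ^ |-γ| / (2 * α)),
    by positivity, fun t ht => ?_⟩
  have ht0 : 0 < t := by linarith
  obtain ⟨Φ, hΦi, hΦb, hΦe⟩ := aux_time_s19 α γ t hα0 ht
  set T : ℝ := ∫ s in Ioc (0:ℝ) t, Φ s with hT
  set J : ℝ := ∫ s in Set.Ioc (0:ℝ) (t / 2), (1 + s) ^ (-γ) with hJ
  have hJ0 : 0 ≤ J := by
    apply setIntegral_nonneg measurableSet_Ioc
    intro s hs
    have : 0 < 1 + s := by linarith [hs.1]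
    positivity
  have hT0 : 0 ≤ T := by rw [hΦe]; positivity
  have hR : 0 < ν * t ^ θ := by positivity
  have hmeas : MeasurableSet {x : EuclideanSpace ℝ (Fin N) | ν * t ^ θ ≤ ‖x‖} :=
    measurableSet_le measurable_const measurable_norm
  -- pointwise bound on the double integral
  have hpt : ∀ x : EuclideanSpace ℝ (Fin N), 0 < ‖x‖ →
      ‖∫ s in Set.Ioc (0:ℝ) t, ∫ y in {y : EuclideanSpace ℝ (Fin N) | ‖y‖ < ‖x‖ / 2},
                Y (x - y) (t - s) * |f y s|‖ ≤ (c₂ * 2 ^ r * C₀ * T) * ‖x‖ ^ (-r) := by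
    intro x hx
    have hball : MeasurableSet {y : EuclideanSpace ℝ (Fin N) | ‖y‖ < ‖x‖ / 2} :=
      measurableSet_lt measurable_norm measurable_const
    have hin : ∀ s ∈ Ioc (0:ℝ) t,
        ‖∫ y in {y : EuclideanSpace ℝ (Fin N) | ‖y‖ < ‖x‖ / 2}, Y (x - y) (t - s) * |f y s|‖ ≤
          c₂ * 2 ^ r * C₀ * ‖x‖ ^ (-r) * Φ s := by
      intro s hs
      have hs1 : 0 < 1 + s := by linarith [hs.1]
      have hts : 0 ≤ t - s := by linarith [hs.2]
      have hfm : Measurable (fun y => f y s) := hfmeas.comp (measurable_id.prodMk measurable_const)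
      have hf1s := hf1 s hs.1.le
      have hfi : Integrable (fun y => f y s) volume :=
        memLp_one_iff_integrable.1 ⟨hfm.aestronglyMeasurable,
          hf1s.trans_lt ENNReal.ofReal_lt_top⟩
      have hfn : ∫ y, |f y s| ≤ C₀ * (1 + s) ^ (-γ) := by
        have h3 : ∫ y, |f y s| = (eLpNorm (fun y => f y s) 1 volume).toReal := by
          rw [eLpNorm_one_eq_lintegral_enorm]
          exact integral_norm_eq_lintegral_enorm hfm.aestronglyMeasurable
        rw [h3]
        exact ENNReal.toReal_le_of_le_ofReal (by positivity) hf1s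
      have hfn' : ∫ y in {y : EuclideanSpace ℝ (Fin N) | ‖y‖ < ‖x‖ / 2}, |f y s| ≤
          C₀ * (1 + s) ^ (-γ) :=
        (setIntegral_le_integral hfi.abs (Eventually.of_forall fun y => abs_nonneg _)).trans hfn
      set D : ℝ := c₂ * 2 ^ r * ‖x‖ ^ (-r) * (t - s) ^ (2 * α - 1) with hD
      have hD0 : 0 ≤ D := by positivity
      calc ‖∫ y in {y : EuclideanSpace ℝ (Fin N) | ‖y‖ < ‖x‖ / 2}, Y (x - y) (t - s) * |f y s|‖
          ≤ ∫ y in {y : EuclideanSpace ℝ (Fin N) | ‖y‖ < ‖x‖ / 2}, D * |f y s| := by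
            refine norm_integral_le_of_norm_le (hfi.abs.integrableOn.const_mul D)
              ((ae_restrict_iff' hball).2 (Eventually.of_forall fun y hy => ?_))
            rw [norm_mul, Real.norm_eq_abs |f y s|, abs_abs]
            exact mul_le_mul_of_nonneg_right (hYb x y (t - s) hx hy hts) (abs_nonneg _)
        _ = D * ∫ y in {y : EuclideanSpace ℝ (Fin N) | ‖y‖ < ‖x‖ / 2}, |f y s| :=
            integral_const_mul _ _
        _ ≤ D * (C₀ * (1 + s) ^ (-γ)) := mul_le_mul_of_nonneg_left hfn' hD0
        _ = c₂ * 2 ^ r * C₀ * ‖x‖ ^ (-r) * ((t - s) ^ (2 * α - 1) * (1 + s) ^ (-γ)) := by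
            rw [hD]; ring
        _ ≤ _ := mul_le_mul_of_nonneg_left (hΦb s hs) (by positivity)
    refine (norm_integral_le_of_norm_le (hΦi.const_mul (c₂ * 2 ^ r * C₀ * ‖x‖ ^ (-r)))
      ((ae_restrict_iff' measurableSet_Ioc).2 (Eventually.of_forall hin))).trans (le_of_eq ?_)
    rw [integral_const_mul, ← hT]
    ring
  have h1 : eLpNorm
          (fun x : EuclideanSpace ℝ (Fin N) =>
            ∫ s in Set.Ioc (0:ℝ) t,
              ∫ y in {y : EuclideanSpace ℝ (Fin N) | ‖y‖ < ‖x‖ / 2},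
                Y (x - y) (t - s) * |f y s|) p
          (volume.restrict {x : EuclideanSpace ℝ (Fin N) | ν * t ^ θ ≤ ‖x‖}) ≤
      eLpNorm (fun x : EuclideanSpace ℝ (Fin N) => (c₂ * 2 ^ r * C₀ * T) * ‖x‖ ^ (-r)) p
          (volume.restrict {x : EuclideanSpace ℝ (Fin N) | ν * t ^ θ ≤ ‖x‖}) :=
    eLpNorm_mono_ae_real ((ae_restrict_iff' hmeas).2
      (Eventually.of_forall fun x hx => hpt x (hR.trans_le hx)))
  refine h1.trans ?_
  rw [show (fun x : EuclideanSpace ℝ (Fin N) => (c₂ * 2 ^ r * C₀ * T) * ‖x‖ ^ (-r)) =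
    (c₂ * 2 ^ r * C₀ * T) • (fun x : EuclideanSpace ℝ (Fin N) => ‖x‖ ^ (-r)) from rfl,
    eLpNorm_const_smul, Real.enorm_of_nonneg (by positivity)]
  refine (mul_le_mul_right (hAb _ hR) _).trans ?_
  rw [← ENNReal.ofReal_mul (by positivity)]
  apply ENNReal.ofReal_le_ofReal
  rw [Real.mul_rpow hν.le (by positivity), ← Real.rpow_mul ht0.le, hΦe, hθN]
  have e1 : t ^ (α - 1 - θ * N * (1 - 1 / p.toReal)) = t ^ (2 * α - 1) * t ^ (θ * e) := by
    rw [← Real.rpow_add ht0]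
    congr 1
    rw [he, hr]
    linear_combination hθβ
  have e2 : t ^ (α - γ - θ * N * (1 - 1 / p.toReal)) =
      t ^ (-γ) * t ^ (2 * α) * t ^ (θ * e) := by
    rw [← Real.rpow_add ht0, ← Real.rpow_add ht0]
    congr 1
    rw [he, hr]
    linear_combination hθβ
  rw [e1, e2]
  have h4 : (t / 2) ^ (2 * α) ≤ t ^ (2 * α) :=
    Real.rpow_le_rpow (by positivity) (by linarith) (by positivity)
  have key : 2 ^ |2 * α - 1| * t ^ (2 * α - 1) * J +
        2 ^ |-γ| * t ^ (-γ) * ((t / 2) ^ (2 * α) / (2 * α)) ≤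
      (2 ^ |2 * α - 1| + 2 ^ |-γ| / (2 * α)) * (t ^ (2 * α - 1) * J + t ^ (-γ) * t ^ (2 * α)) := by
    have h5 : 2 ^ |-γ| * t ^ (-γ) * ((t / 2) ^ (2 * α) / (2 * α)) ≤
        2 ^ |-γ| * t ^ (-γ) * (t ^ (2 * α) / (2 * α)) := by gcongr
    have h6 : 0 ≤ 2 ^ |2 * α - 1| * (t ^ (-γ) * t ^ (2 * α)) := by positivity
    have h7 : 0 ≤ 2 ^ |-γ| / (2 * α) * (t ^ (2 * α - 1) * J) := by positivity
    calc _ ≤ 2 ^ |2 * α - 1| * t ^ (2 * α - 1) * J +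
          2 ^ |-γ| * t ^ (-γ) * (t ^ (2 * α) / (2 * α)) := by linarith
      _ ≤ 2 ^ |2 * α - 1| * t ^ (2 * α - 1) * J +
          2 ^ |-γ| * t ^ (-γ) * (t ^ (2 * α) / (2 * α)) +
          2 ^ |2 * α - 1| * (t ^ (-γ) * t ^ (2 * α)) +
          2 ^ |-γ| / (2 * α) * (t ^ (2 * α - 1) * J) := by linarith
      _ = _ := by ring
  have h8 : 0 ≤ c₂ * 2 ^ r * C₀ * A * ν ^ e * t ^ (θ * e) := by positivity
  have h9 := mul_le_mul_of_nonneg_left key h8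
  refine le_trans (le_of_eq ?_) (h9.trans (le_of_eq ?_)) <;> ring
end
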